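/- arXiv:1408.2105 — 7 statements merged into one kernel-verified Lean document; each statement's English description precedes it below -/
import Mathlib

section
/- For every natural number ℓ ≥ 1, setting s = 4ℓ+3: the polynomial det M_s is irreducible in R_s, and it vanishes at the coordinates of every sum of 3ℓ+2 rank-one partially skew-symmetric tensors; that is, for all v : Fin (3ℓ+2) → (Fin 3 → ℂ) and w, u : Fin (3ℓ+2) → (Fin s → ℂ), evaluating det M_s at the assignment X(m,k,l) ↦ ∑_{i : Fin (3ℓ+2)} (v i m) · ((w i k)·(u i l) − (w i l)·(u i k)) gives 0. (This says the determinant of the exterior flattening generates the prime ideal of the hypersurface σ_{3ℓ+2}(Seg(ℙ² × 𝔾(1,4ℓ+2))).) -/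
open scoped BigOperators

/-- The exterior flattening of a tensor `t` (skew-symmetric in its last two indices). -/
def extFlattening {n : ℕ} {R : Type*} [CommRing R] (t : Fin 3 → Fin n → Fin n → R) :
    Matrix (Fin 3 × Fin n) (Fin 3 × Fin n) R := fun p q =>
  if p.1 = 0 ∧ q.1 = 1 then t 0 p.2 q.2
  else if p.1 = 1 ∧ q.1 = 0 then -t 0 p.2 q.2
  else if p.1 = 0 ∧ q.1 = 2 then -t 1 p.2 q.2
  else if p.1 = 2 ∧ q.1 = 0 then t 1 p.2 q.2
  else if p.1 = 1 ∧ q.1 = 2 then t 2 p.2 q.2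
  else if p.1 = 2 ∧ q.1 = 1 then -t 2 p.2 q.2
  else 0

/-- The generic skew-symmetric tensor with `MvPolynomial` entries. -/
noncomputable def genericSkew (s : ℕ) :
    Fin 3 → Fin s → Fin s → MvPolynomial (Fin 3 × Fin s × Fin s) ℂ := fun m k l =>
  if k < l then MvPolynomial.X (m, k, l)
  else if l < k then -MvPolynomial.X (m, l, k)
  else 0

/-- `det M_s`, the determinant of the ⊠-product of a generic `3×3` skew-symmetric
matrix with a generic `s×s` skew-symmetric matrix. -/
noncomputable def detM (s : ℕ) : MvPolynomial (Fin 3 × Fin s × Fin s) ℂ :=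
  (extFlattening (genericSkew s)).det

open Matrix

section Univariate

open Polynomial

/-- A factor of a monomial `c * x ^ N` is a monomial. -/
theorem Polynomial.exists_eval_eq_pow_of_eval_mul_eval {p q : ℂ[X]} {c : ℂ} (hc : c ≠ 0) {N : ℕ}
    (hpq : ∀ x, p.eval x * q.eval x = c * x ^ N) : ∃ a ≤ N, p = C (p.eval 1) * X ^ a := by
  have h : p * q = C c * X ^ N := Polynomial.funext fun x => by simpa using hpq x
  have hdvd : p ∣ X ^ N := by
    have : p ∣ C c * X ^ N := ⟨q, h.symm⟩
    exact ((isUnit_C.2 hc.isUnit).dvd_mul_left).1 this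
  obtain ⟨a, ha, u, hu⟩ := (dvd_prime_pow prime_X N).1 hdvd
  obtain ⟨b, hb, hb'⟩ := Polynomial.isUnit_iff.1 (u⁻¹).isUnit
  have hp : p = C b * X ^ a := by
    rw [hb', ← hu, mul_comm, mul_assoc, Units.mul_inv, mul_one]
  refine ⟨a, ha, ?_⟩
  conv_lhs => rw [hp]
  simp [hp]

theorem MvPolynomial.eval_polynomial_eval {σ : Type*} (g : MvPolynomial σ ℂ) (q : σ → ℂ[X])
    (r : ℂ) : MvPolynomial.eval (fun i => (q i).eval r) g = (MvPolynomial.aeval q g).eval r := by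
  induction g using MvPolynomial.induction_on with
  | C a => simp
  | add p q hp hq => simp [hp, hq]
  | mul_X p i hp => simp [hp]

/-- A function on matrices which is polynomial on every affine line. -/
def PolynomialOnLines {n : Type*} (G : Matrix n n ℂ → ℂ) : Prop :=
  ∀ A B, ∃ p : ℂ[X], ∀ r, G (A + r • B) = p.eval r

end Univariate

section Factor

/-- The matrix with diagonal `D`, outside of the rows `i` and `j`, and with the `2 × 2` block
`!![a, b; c, d]` in the rows and columns `i`, `j`. -/
def blockTwo {n : Type*} [DecidableEq n] (i j : n) (D : n → ℂ) (a b c d : ℂ) : Matrix n n ℂ :=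
  fun p q =>
  if p = i then if q = i then a else if q = j then b else 0
  else if p = j then if q = i then c else if q = j then d else 0
  else if p = q then D p else 0

theorem diagonal_eq_blockTwo {n : Type*} [DecidableEq n] {i j : n} (D : n → ℂ) :
    diagonal D = blockTwo i j D (D i) 0 0 (D j) := by
  ext p q
  simp only [blockTwo, diagonal_apply]
  split_ifs <;> simp_all

variable {n : Type*} [Fintype n] [DecidableEq n] {G H : Matrix n n ℂ → ℂ} {c : ℂ} {N : ℕ}

/-- A factor of a power of the determinant is invariant under transvections. -/
theorem PolynomialOnLines.transvection_mul (hG : PolynomialOnLines G) (hH : PolynomialOnLines H)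
    (hc : c ≠ 0) (hGH : ∀ Q, G Q * H Q = c * Q.det ^ N) {i j : n} (hij : i ≠ j) (r : ℂ)
    {M : Matrix n n ℂ} (hM : M.det ≠ 0) : G (transvection i j r * M) = G M := by
  have key : ∀ r : ℂ, transvection i j r * M = M + r • (Matrix.single i j 1 * M) := fun r => by
    rw [transvection, add_mul, one_mul, ← smul_mul_assoc]
    simp
  obtain ⟨p, hp⟩ := hG M (Matrix.single i j 1 * M)
  obtain ⟨q, hq⟩ := hH M (Matrix.single i j 1 * M)
  obtain ⟨a, ha, h⟩ := Polynomial.exists_eval_eq_pow_of_eval_mul_eval (p := p) (q := q)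
    (c := c * M.det ^ N) (N := 0) (by positivity) fun x => by
      rw [← hp, ← hq, ← key, hGH, det_mul, det_transvection_of_ne _ _ hij]
      simp
  obtain rfl : a = 0 := by omega
  have h0 : p.eval r = p.eval 0 := by rw [h]; simp
  rw [key, hp, h0, ← hp]
  simp

theorem transvection_mul_blockTwo {i j : n} (hij : i ≠ j) (D : n → ℂ) (a b c d r : ℂ) :
    transvection i j r * blockTwo i j D a b c d =
      blockTwo i j D (a + r * c) (b + r * d) c d := by
  ext p q
  by_cases hp : p = i
  · subst hp
    rw [transvection_mul_apply_same]
    simp only [blockTwo, hij.symm, if_true, if_false]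
    split_ifs <;> ring
  · rw [transvection_mul_apply_of_ne _ _ _ _ hp]
    simp [blockTwo, hp]

theorem transvection_mul_blockTwo' {i j : n} (hij : i ≠ j) (D : n → ℂ) (a b c d r : ℂ) :
    transvection j i r * blockTwo i j D a b c d =
      blockTwo i j D a b (c + r * a) (d + r * b) := by
  ext p q
  by_cases hp : p = j
  · subst hp
    rw [transvection_mul_apply_same]
    simp only [blockTwo, hij.symm, if_true, if_false]
    split_ifs <;> ring
  · rw [transvection_mul_apply_of_ne _ _ _ _ hp]
    simp [blockTwo, hp]

theorem PolynomialOnLines.diagonal_update (hG : PolynomialOnLines G) (hH : PolynomialOnLines H)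
    (hc : c ≠ 0) (hGH : ∀ Q, G Q * H Q = c * Q.det ^ N) {i j : n} (hij : i ≠ j) (D : n → ℂ)
    (hD : ∀ k, D k ≠ 0) :
    G (diagonal D) = G (diagonal (Function.update (Function.update D i 1) j (D i * D j))) := by
  have hi := hD i
  have hdet : (blockTwo i j D (D i) 0 0 (D j)).det ≠ 0 := by
    rw [← diagonal_eq_blockTwo, det_diagonal]
    exact Finset.prod_ne_zero_iff.2 fun k _ => hD k
  have e : diagonal (Function.update (Function.update D i 1) j (D i * D j)) =
      transvection i j (-(1 - D i) / D i) * (transvection j i (-1) * (transvection i j (1 - D i) *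
        (transvection j i (1 / D i) * blockTwo i j D (D i) 0 0 (D j)))) := by
    rw [transvection_mul_blockTwo' hij, transvection_mul_blockTwo hij,
      transvection_mul_blockTwo' hij, transvection_mul_blockTwo hij, diagonal_eq_blockTwo (i := i)
      (j := j)]
    ext p q
    simp only [blockTwo, Function.update_apply, hij, if_true, if_false]
    split_ifs <;> field_simp <;> ring
  have hT : ∀ {p q : n} (_ : p ≠ q) (r : ℂ) {M : Matrix n n ℂ}, M.det ≠ 0 →
      (transvection p q r * M).det ≠ 0 := fun h r M hM => by
    rwa [det_mul, det_transvection_of_ne _ _ h, one_mul]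
  have h1 := hT hij.symm (1 / D i) hdet
  have h2 := hT hij (1 - D i) h1
  have h3 := hT hij.symm (-1) h2
  rw [e, hG.transvection_mul hH hc hGH hij _ h3, hG.transvection_mul hH hc hGH hij.symm _ h2,
    hG.transvection_mul hH hc hGH hij _ h1, hG.transvection_mul hH hc hGH hij.symm _ hdet,
    ← diagonal_eq_blockTwo]

theorem PolynomialOnLines.diagonal_eq_diagonal_update_one (hG : PolynomialOnLines G)
    (hH : PolynomialOnLines H) (hc : c ≠ 0) (hGH : ∀ Q, G Q * H Q = c * Q.det ^ N) (k₀ : n)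
    (D : n → ℂ) (hD : ∀ k, D k ≠ 0) :
    G (diagonal D) = G (diagonal (Function.update 1 k₀ (∏ k, D k))) := by
  suffices h : ∀ (S : Finset n), k₀ ∉ S → ∀ D : n → ℂ, (∀ k, D k ≠ 0) →
      (∀ k, k ∉ S → k ≠ k₀ → D k = 1) →
      G (diagonal D) = G (diagonal (Function.update 1 k₀ (∏ k, D k))) from
    h (Finset.univ.erase k₀) (by simp) D hD (by simp +contextual)
  intro S
  induction S using Finset.induction_on with
  | empty =>
    intro _ D _ h1
    congr 2
    ext k
    by_cases hk : k = k₀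
    · subst hk
      rw [Function.update_self, Finset.prod_eq_single k (fun b _ hb => h1 b (by simp) hb) (by simp)]
    · simp [hk, h1]
  | insert i S hi ih =>
    intro hk D hD h1
    have hik : i ≠ k₀ := by rintro rfl; simp at hk
    rw [hG.diagonal_update hH hc hGH hik D hD, ih (fun h => hk (by simp [h]))]
    · congr 3
      rw [← Finset.mul_prod_erase _ _ (Finset.mem_univ k₀),
        ← Finset.mul_prod_erase _ _ (Finset.mem_univ k₀),
        ← Finset.mul_prod_erase _ _ (show i ∈ Finset.univ.erase k₀ by simp [hik]),
        ← Finset.mul_prod_erase _ _ (show i ∈ Finset.univ.erase k₀ by simp [hik]),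
        Finset.prod_congr rfl (g := D)]
      · simp [hik]; ring
      · intro x hx
        simp only [Finset.mem_erase] at hx
        simp [hx.1, hx.2.1]
    · intro k
      simp only [Function.update_apply]
      split_ifs <;> simp [hD]
    · intro k hkS hkk
      simp only [Function.update_apply, hkk, if_false]
      split_ifs with h
      · rfl
      · exact h1 k (by simp [h, hkS]) hkk

/-- A factor of a power of the determinant is a power of the determinant on diagonal matrices. -/
theorem PolynomialOnLines.exists_diagonal_eq_pow [Nonempty n] (hG : PolynomialOnLines G)
    (hH : PolynomialOnLines H) (hc : c ≠ 0) (hGH : ∀ Q, G Q * H Q = c * Q.det ^ N) :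
    ∃ a : ℕ, ∀ D : n → ℂ, (∀ k, D k ≠ 0) → G (diagonal D) = G 1 * (∏ k, D k) ^ a := by
  obtain ⟨k₀⟩ := ‹Nonempty n›
  have key : ∀ x : ℂ, diagonal (Function.update 1 k₀ x) =
      diagonal (Function.update 1 k₀ 0) + x • Matrix.single k₀ k₀ (1 : ℂ) := fun x => by
    ext p q
    simp only [diagonal_apply, Matrix.add_apply, Matrix.smul_apply, Matrix.single_apply,
      Function.update_apply, smul_eq_mul]
    grind
  obtain ⟨p, hp⟩ := hG (diagonal (Function.update 1 k₀ 0)) (Matrix.single k₀ k₀ 1)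
  obtain ⟨q, hq⟩ := hH (diagonal (Function.update 1 k₀ 0)) (Matrix.single k₀ k₀ 1)
  simp only [← key] at hp hq
  obtain ⟨a, -, h⟩ := Polynomial.exists_eval_eq_pow_of_eval_mul_eval (p := p) (q := q) hc
    (N := N) fun x => by
      rw [← hp, ← hq, hGH, det_diagonal]
      congr 2
      rw [Finset.prod_update_of_mem (Finset.mem_univ _)]
      simp
  refine ⟨a, fun D hD => ?_⟩
  have h1 : G 1 = p.eval 1 := by
    rw [← hp, ← diagonal_one]
    exact congrArg (fun D => G (diagonal D)) (Function.update_eq_self k₀ (1 : n → ℂ)).symm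
  rw [hG.diagonal_eq_diagonal_update_one hH hc hGH k₀ D hD, hp, h, h1]
  simp

end Factor

section Flattening

variable {s : ℕ}

/-- The coordinates of a tensor. -/
def tensorCoord (T : Fin 3 → Fin s → Fin s → ℂ) : Fin 3 × Fin s × Fin s → ℂ :=
  fun p => T p.1 p.2.1 p.2.2

theorem eval_detM {T : Fin 3 → Fin s → Fin s → ℂ} (hT : ∀ m k l, T m k l = -T m l k) :
    MvPolynomial.eval (tensorCoord T) (detM s) = (extFlattening T).det := by
  rw [detM, RingHom.map_det]
  congr 1
  have key : ∀ m k l, MvPolynomial.eval (tensorCoord T) (genericSkew s m k l) = T m k l := by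
    intro m k l
    unfold genericSkew
    split_ifs with h1 h2
    · simp [tensorCoord]
    · simp [tensorCoord, hT m k l]
    · obtain rfl : k = l := by omega
      simpa using (self_eq_neg.1 (hT m k k)).symm
  ext p q
  simp only [RingHom.mapMatrix_apply, map_apply, extFlattening]
  split_ifs <;> simp [key]

theorem extFlattening_swap (T : Fin 3 → Fin s → Fin s → ℂ) (i j : Fin 3) (k l : Fin s) :
    extFlattening T (i, k) (j, l) = -extFlattening T (j, k) (i, l) := by
  fin_cases i <;> fin_cases j <;> simp [extFlattening]

theorem extFlattening_transpose {T : Fin 3 → Fin s → Fin s → ℂ}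
    (hT : ∀ m k l, T m k l = -T m l k) : (extFlattening T)ᵀ = extFlattening T := by
  ext ⟨i, k⟩ ⟨j, l⟩
  fin_cases i <;> fin_cases j <;> simp [extFlattening, hT _ l k]

theorem extFlattening_smul (c : ℂ) (T : Fin 3 → Fin s → Fin s → ℂ) :
    extFlattening (c • T) = c • extFlattening T := by
  ext ⟨i, k⟩ ⟨j, l⟩
  fin_cases i <;> fin_cases j <;> simp [extFlattening]

/-- The tensor whose exterior flattening is a given matrix. -/
def unflatten (S : Matrix (Fin 3 × Fin s) (Fin 3 × Fin s) ℂ) : Fin 3 → Fin s → Fin s → ℂ :=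
  fun m k l => S (![0, 2, 1] m, k) (![1, 0, 2] m, l)

theorem unflatten_extFlattening (T : Fin 3 → Fin s → Fin s → ℂ) :
    unflatten (extFlattening T) = T := by
  ext m k l
  fin_cases m <;> simp [extFlattening, unflatten]

theorem extFlattening_unflatten {S : Matrix (Fin 3 × Fin s) (Fin 3 × Fin s) ℂ}
    (hS : ∀ i j k l, S (i, k) (j, l) = -S (j, k) (i, l)) : extFlattening (unflatten S) = S := by
  have h0 : ∀ i k l, S (i, k) (i, l) = 0 := fun i k l => self_eq_neg.1 (hS i i k l)
  ext ⟨i, k⟩ ⟨j, l⟩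
  fin_cases i <;> fin_cases j <;> simp [extFlattening, unflatten, h0] <;> rw [hS, neg_neg]

theorem unflatten_skew {S : Matrix (Fin 3 × Fin s) (Fin 3 × Fin s) ℂ} (hSt : Sᵀ = S)
    (hS : ∀ i j k l, S (i, k) (j, l) = -S (j, k) (i, l)) (m : Fin 3) (k l : Fin s) :
    unflatten S m k l = -unflatten S m l k := by
  unfold unflatten
  rw [hS, ← congrFun (congrFun hSt _) _, transpose_apply]

/-- If an affine family of matrices acts on an exterior flattening by congruence, preserving the
shape of exterior flattenings, then a factor of `detM s` changes by a power of the determinant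
along the diagonal matrices. -/
theorem exists_eval_unflatten_eq_pow {T : Fin 3 → Fin s → Fin s → ℂ}
    (hT : ∀ m k l, T m k l = -T m l k) (hf : (extFlattening T).det ≠ 0)
    {g h : MvPolynomial (Fin 3 × Fin s × Fin s) ℂ} (hgh : detM s = g * h)
    {n : Type*} [Fintype n] [DecidableEq n] [Nonempty n]
    (D : Matrix n n ℂ → Matrix (Fin 3 × Fin s) (Fin 3 × Fin s) ℂ) (hD1 : D 1 = 1)
    (hD : ∀ A B, ∃ B', ∀ r : ℂ, D (A + r • B) = D A + r • B') (N : ℕ)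
    (hdet : ∀ Q, (D Q).det ^ 2 = Q.det ^ N)
    (hswap : ∀ Q i j k l, (D Q * extFlattening T * (D Q)ᵀ) (i, k) (j, l) =
      -(D Q * extFlattening T * (D Q)ᵀ) (j, k) (i, l)) :
    ∃ a : ℕ, ∀ d : n → ℂ, (∀ k, d k ≠ 0) →
      MvPolynomial.eval (tensorCoord (unflatten
        (D (diagonal d) * extFlattening T * (D (diagonal d))ᵀ))) g =
      MvPolynomial.eval (tensorCoord T) g * (∏ k, d k) ^ a := by
  have hpoly : ∀ g : MvPolynomial (Fin 3 × Fin s × Fin s) ℂ, PolynomialOnLines fun Q =>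
      MvPolynomial.eval (tensorCoord (unflatten (D Q * extFlattening T * (D Q)ᵀ))) g := by
    intro g A B
    obtain ⟨B', hB'⟩ := hD A B
    refine ⟨MvPolynomial.aeval (fun p : Fin 3 × Fin s × Fin s =>
      ∑ x, (∑ y, (Polynomial.C (D A (![0, 2, 1] p.1, p.2.1) y) +
        Polynomial.X * Polynomial.C (B' (![0, 2, 1] p.1, p.2.1) y)) *
          Polynomial.C (extFlattening T y x)) *
        (Polynomial.C (D A (![1, 0, 2] p.1, p.2.2) x) +
          Polynomial.X * Polynomial.C (B' (![1, 0, 2] p.1, p.2.2) x))) g, fun r => ?_⟩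
    simp only [← MvPolynomial.eval_polynomial_eval]
    congr 2
    ext p
    rw [hB']
    simp only [tensorCoord, unflatten, Matrix.mul_apply, Polynomial.eval_finsetSum,
      Polynomial.eval_mul, Polynomial.eval_add, Polynomial.eval_C, Polynomial.eval_X,
      Matrix.add_apply, Matrix.smul_apply, Matrix.transpose_apply, smul_eq_mul]
  have hprod : ∀ Q, MvPolynomial.eval (tensorCoord (unflatten
        (D Q * extFlattening T * (D Q)ᵀ))) g * MvPolynomial.eval (tensorCoord (unflatten
        (D Q * extFlattening T * (D Q)ᵀ))) h = (extFlattening T).det * Q.det ^ N := by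
    intro Q
    rw [← map_mul, ← hgh, eval_detM, extFlattening_unflatten (hswap Q), det_mul, det_mul,
      det_transpose, ← hdet]
    · ring
    · refine unflatten_skew ?_ (hswap Q)
      simp [extFlattening_transpose hT, Matrix.mul_assoc]
  obtain ⟨a, ha⟩ := (hpoly g).exists_diagonal_eq_pow (hpoly h) hf hprod
  refine ⟨a, fun d hd => ?_⟩
  rw [ha d hd]
  simp [hD1, unflatten_extFlattening]

/-- The restriction of a factor of `detM s` to a line through the origin is a monomial. -/
theorem exists_eval_smul_eq_pow {T : Fin 3 → Fin s → Fin s → ℂ}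
    (hT : ∀ m k l, T m k l = -T m l k) (hf : (extFlattening T).det ≠ 0)
    {g h : MvPolynomial (Fin 3 × Fin s × Fin s) ℂ} (hgh : detM s = g * h) :
    ∃ a ≤ g.totalDegree, ∀ r : ℂ, MvPolynomial.eval (tensorCoord (r • T)) g =
      MvPolynomial.eval (tensorCoord T) g * r ^ a := by
  have key : ∀ (g : MvPolynomial (Fin 3 × Fin s × Fin s) ℂ) (r : ℂ),
      MvPolynomial.eval (tensorCoord (r • T)) g = (MvPolynomial.aeval
        (fun p => Polynomial.X * Polynomial.C (tensorCoord T p)) g).eval r := by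
    intro g r
    rw [← MvPolynomial.eval_polynomial_eval]
    congr 2
    ext p
    simp only [tensorCoord, Pi.smul_apply, smul_eq_mul, Polynomial.eval_mul, Polynomial.eval_X,
      Polynomial.eval_C]
  have h1 : ∀ g : MvPolynomial (Fin 3 × Fin s × Fin s) ℂ, (MvPolynomial.aeval
        (fun p => Polynomial.X * Polynomial.C (tensorCoord T p)) g).eval 1 =
        MvPolynomial.eval (tensorCoord T) g := fun g => by
    rw [← key, one_smul]
  obtain ⟨a, -, ha⟩ := Polynomial.exists_eval_eq_pow_of_eval_mul_eval (N := 3 * s)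
    (p := MvPolynomial.aeval (fun p => Polynomial.X * Polynomial.C (tensorCoord T p)) g)
    (q := MvPolynomial.aeval (fun p => Polynomial.X * Polynomial.C (tensorCoord T p)) h) hf
    fun r => by
      rw [← key, ← key, ← map_mul, ← hgh, eval_detM, extFlattening_smul, det_smul]
      · simp [mul_comm]
      · intro m k l
        rw [Pi.smul_apply, Pi.smul_apply, Pi.smul_apply, hT m k l]
        simp
  refine ⟨a, ?_, fun r => ?_⟩
  · have hg : MvPolynomial.eval (tensorCoord T) g ≠ 0 := fun h0 => hf <| by
      rw [← eval_detM hT, hgh, map_mul, h0, zero_mul]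
    have hdeg := MvPolynomial.aeval_natDegree_le g le_rfl
      (fun p => Polynomial.X * Polynomial.C (tensorCoord T p)) (n := 1) fun p =>
        (Polynomial.natDegree_mul_C_le _ _).trans Polynomial.natDegree_X_le
    rwa [ha, h1, Polynomial.natDegree_C_mul_X_pow _ _ hg, mul_one] at hdeg
  · rw [key, ha, h1]
    simp

end Flattening

section Quaternion

/-- Left multiplication by the imaginary quaternion units, as sign patterns: the row `k` of the
`m`-th matrix has its only nonzero entry in the column `k ^^^ (m + 1)`. -/
def quaternionSign : Fin 3 → Fin 4 → ℂ :=
  ![![-1, 1, -1, 1], ![-1, 1, 1, -1], ![-1, -1, 1, 1]]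

/-- The column of the nonzero entry of each row. -/
def quaternionIndex : Fin 3 → Fin 4 → Fin 4 :=
  ![![1, 0, 3, 2], ![2, 3, 0, 1], ![3, 2, 1, 0]]

/-- The remainder modulo four, as an element of `Fin 4`. -/
def mod4 (k : ℕ) : Fin 4 := ⟨k % 4, Nat.mod_lt _ (by norm_num)⟩

/-- The block diagonal tensor whose blocks are the left multiplications by the imaginary quaternion
units, the last block being truncated to size `s % 4`. -/
def quaternionTensor (s : ℕ) : Fin 3 → Fin s → Fin s → ℂ := fun m k l =>
  if l.val = 4 * (k.val / 4) + (quaternionIndex m (mod4 k)).val then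
    quaternionSign m (mod4 k) else 0

theorem quaternionIndex_involutive (m : Fin 3) (k : Fin 4) :
    quaternionIndex m (quaternionIndex m k) = k := by
  fin_cases m <;> fin_cases k <;> rfl

theorem quaternionSign_quaternionIndex (m : Fin 3) (k : Fin 4) :
    quaternionSign m (quaternionIndex m k) = -quaternionSign m k := by
  fin_cases m <;> fin_cases k <;> simp [quaternionSign, quaternionIndex]

theorem mod4_four_mul_add (b : ℕ) (i : Fin 4) : mod4 (4 * b + i) = i := by
  ext
  simp only [mod4]
  omega

theorem quaternionTensor_skew (s : ℕ) (m : Fin 3) (k l : Fin s) :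
    quaternionTensor s m k l = -quaternionTensor s m l k := by
  have h : ∀ k l : ℕ, l = 4 * (k / 4) + (quaternionIndex m (mod4 k)).val →
      k = 4 * (l / 4) + (quaternionIndex m (mod4 l)).val := by
    intro k l h
    have h1 := (quaternionIndex m (mod4 k)).isLt
    have h2 : mod4 l = quaternionIndex m (mod4 k) := by rw [h, mod4_four_mul_add]
    rw [h2, quaternionIndex_involutive]
    simp only [mod4]
    omega
  by_cases hl : l.val = 4 * (k.val / 4) + (quaternionIndex m (mod4 k)).val
  · rw [quaternionTensor, quaternionTensor, if_pos hl, if_pos (h _ _ hl), hl, mod4_four_mul_add,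
      quaternionSign_quaternionIndex, neg_neg]
  · rw [quaternionTensor, quaternionTensor, if_neg hl, if_neg fun h' => hl (h _ _ h'), neg_zero]

theorem quaternionTensor_eq_zero {s : ℕ} (m : Fin 3) {k l : Fin s} (h : ¬(k.val < 4 ↔ l.val < 4)) :
    quaternionTensor s m k l = 0 := by
  refine if_neg fun h' => h ?_
  have := (quaternionIndex m (mod4 k)).isLt
  omega

/-- The exterior flattening of the quaternion tensor is nonsingular. -/
theorem det_extFlattening_quaternionTensor (ℓ : ℕ) :
    (extFlattening (quaternionTensor (4 * ℓ + 3))).det ≠ 0 := by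
  intro h0
  obtain ⟨x, hx0, hx⟩ := Matrix.exists_mulVec_eq_zero_iff.2 h0
  apply hx0
  obtain ⟨y, hy⟩ : ∃ y : Fin 3 → ℕ → ℂ, y = fun j l =>
    if h : l < 4 * ℓ + 3 then x (j, ⟨l, h⟩) else 0 := ⟨_, rfl⟩
  have hyx : ∀ j (k : Fin (4 * ℓ + 3)), x (j, k) = y j k := fun j k => by simp [hy]
  have hy0 : ∀ j l, 4 * ℓ + 3 ≤ l → y j l = 0 := fun j l hl => by
    rw [hy]; exact dif_neg (by omega)
  have hsum : ∀ m j (k : Fin (4 * ℓ + 3)), ∑ l, quaternionTensor _ m k l * x (j, l) =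
      quaternionSign m (mod4 k) * y j (4 * (k.val / 4) + quaternionIndex m (mod4 k)) := by
    intro m j k
    simp only [quaternionTensor, ite_mul, zero_mul]
    by_cases h : 4 * (k.val / 4) + (quaternionIndex m (mod4 k)).val < 4 * ℓ + 3
    · rw [Finset.sum_eq_single ⟨_, h⟩]
      · rw [if_pos rfl, hyx]
      · exact fun l _ hl => if_neg fun h' => hl (Fin.ext h')
      · simp
    · rw [hy0 _ _ (by omega), mul_zero]
      exact Finset.sum_eq_zero fun l _ => if_neg (by omega)
  have heq : ∀ i (k : Fin (4 * ℓ + 3)),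
      ∑ j, ∑ l, extFlattening (quaternionTensor _) (i, k) (j, l) * x (j, l) = 0 := fun i k => by
    rw [← Fintype.sum_prod_type']
    exact congrFun hx (i, k)
  have hE : ∀ b (r : Fin 4), 4 * b + r.val < 4 * ℓ + 3 →
      quaternionSign 0 r * y 1 (4 * b + quaternionIndex 0 r) -
        quaternionSign 1 r * y 2 (4 * b + quaternionIndex 1 r) = 0 ∧
      -(quaternionSign 0 r * y 0 (4 * b + quaternionIndex 0 r)) +
        quaternionSign 2 r * y 2 (4 * b + quaternionIndex 2 r) = 0 ∧
      quaternionSign 1 r * y 0 (4 * b + quaternionIndex 1 r) -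
        quaternionSign 2 r * y 1 (4 * b + quaternionIndex 2 r) = 0 := by
    intro b r h
    have hm : ∀ m j, ∑ l, quaternionTensor (4 * ℓ + 3) m ⟨_, h⟩ l * x (j, l) =
        quaternionSign m r * y j (4 * b + quaternionIndex m r) := fun m j => by
      rw [hsum]
      simp only [mod4_four_mul_add]
      congr 3
      omega
    have h0 := heq 0 ⟨_, h⟩
    have h1 := heq 1 ⟨_, h⟩
    have h2 := heq 2 ⟨_, h⟩
    simp [Fin.sum_univ_three, extFlattening, hm, Finset.sum_neg_distrib] at h0 h1 h2
    exact ⟨by linear_combination h0, by linear_combination h1, by linear_combination h2⟩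
  have hb : ∀ b, b ≤ ℓ → ∀ (r : Fin 4) j, y j (4 * b + r) = 0 := by
    intro b hb
    have e0 := hE b 0
    have e1 := hE b 1
    have e2 := hE b 2
    have e3 := hE b 3
    have z := fun j => hy0 j (4 * b + 3)
    simp [quaternionSign, quaternionIndex] at e0 e1 e2 e3
    obtain ⟨a0, b0, c0⟩ := e0 (by omega)
    obtain ⟨a1, b1, c1⟩ := e1 (by omega)
    obtain ⟨a2, b2, c2⟩ := e2 (by omega)
    clear e0 e1 e2
    by_cases hbl : b = ℓ
    · have z0 := z 0 (by omega)
      have z1 := z 1 (by omega)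
      have z2 := z 2 (by omega)
      intro r j
      fin_cases r <;> fin_cases j <;> simp <;> grind
    · obtain ⟨a3, b3, c3⟩ := e3 (by omega)
      intro r j
      fin_cases r <;> fin_cases j <;> simp <;> grind
  ext ⟨j, k⟩
  rw [hyx]
  have := hb (k.val / 4) (by omega) (mod4 k) j
  simp only [mod4, Nat.div_add_mod] at this
  simpa using this

end Quaternion

section Irreducible

variable {s : ℕ}

theorem unflatten_diagonal_mul (T : Fin 3 → Fin s → Fin s → ℂ) (e : Fin 3 × Fin s → ℂ)
    (c : Fin s → Fin s → ℂ)
    (hc : ∀ m k l, T m k l ≠ 0 → e (![0, 2, 1] m, k) * e (![1, 0, 2] m, l) = c k l) :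
    unflatten (diagonal e * extFlattening T * (diagonal e)ᵀ) = fun m k l => c k l * T m k l := by
  ext m k l
  rw [unflatten, diagonal_transpose, mul_diagonal, diagonal_mul]
  change _ * unflatten (extFlattening T) m k l * _ = _
  rw [unflatten_extFlattening]
  by_cases h : T m k l = 0
  · simp [h]
  · rw [← hc m k l h]
    ring

/-- Rescaling the coordinates of `Fin s` multiplies a factor of `detM s` by a power of the product
of the scaling factors. -/
theorem exists_eval_mul_eq_pow_card {T : Fin 3 → Fin s → Fin s → ℂ} [Nonempty (Fin s)]
    (hT : ∀ m k l, T m k l = -T m l k) (hf : (extFlattening T).det ≠ 0)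
    {g h : MvPolynomial (Fin 3 × Fin s × Fin s) ℂ} (hgh : detM s = g * h) :
    ∃ a : ℕ, ∀ d : Fin s → ℂ, (∀ k, d k ≠ 0) →
      MvPolynomial.eval (tensorCoord fun m k l => d k * d l * T m k l) g =
      MvPolynomial.eval (tensorCoord T) g * (∏ k, d k) ^ a := by
  obtain ⟨a, ha⟩ := exists_eval_unflatten_eq_pow hT hf hgh
    (fun Q : Matrix (Fin s) (Fin s) ℂ => kroneckerMap (· * ·) (1 : Matrix (Fin 3) (Fin 3) ℂ) Q)
    (by simp) (fun A B => ⟨kroneckerMap (· * ·) 1 B, fun r => by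
      rw [kroneckerMap_add_right _ mul_add,
        kroneckerMap_smul_right _ _ fun _ _ => mul_smul_comm _ _ _]⟩) 6
    (fun Q => by rw [det_kronecker]; simp [← pow_mul]) (fun Q i j k l => by
      have key : ∀ i j k l, (kroneckerMap (· * ·) (1 : Matrix (Fin 3) (Fin 3) ℂ) Q *
          extFlattening T *
          (kroneckerMap (· * ·) (1 : Matrix (Fin 3) (Fin 3) ℂ) Q)ᵀ) (i, k) (j, l) =
          ∑ l', (∑ k', Q k k' * extFlattening T (i, k') (j, l')) * Q l l' := fun i j k l => by
        simp [Matrix.mul_apply, Fintype.sum_prod_type, one_apply, ite_mul, mul_ite]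
      simp only [key, extFlattening_swap T i j]
      simp)
  refine ⟨a, fun d hd => ?_⟩
  rw [← ha d hd]
  congr 2
  have : kroneckerMap (· * ·) (1 : Matrix (Fin 3) (Fin 3) ℂ) (diagonal d) =
      diagonal fun p : Fin 3 × Fin s => d p.2 := by
    rw [← diagonal_one, diagonal_kronecker_diagonal]
    simp
  simp only [this]
  rw [unflatten_diagonal_mul T _ (fun k l => d k * d l) (by simp)]

/-- Rescaling the first diagonal block of a block diagonal tensor, through the scalar matrices of
size three, multiplies a factor of `detM s` by a power of the determinant of the scalar matrix. -/
theorem exists_eval_mul_eq_pow_three (hs : 4 ≤ s) {T : Fin 3 → Fin s → Fin s → ℂ}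
    (hT : ∀ m k l, T m k l = -T m l k) (hf : (extFlattening T).det ≠ 0)
    (hT0 : ∀ m (k l : Fin s), ¬(k.val < 4 ↔ l.val < 4) → T m k l = 0)
    {g h : MvPolynomial (Fin 3 × Fin s × Fin s) ℂ} (hgh : detM s = g * h) :
    ∃ a : ℕ, ∀ r : ℂ, r ≠ 0 →
      MvPolynomial.eval (tensorCoord fun m k l => (if k.val < 4 then r ^ 2 else 1) * T m k l) g =
      MvPolynomial.eval (tensorCoord T) g * (r ^ 3) ^ a := by
  have hE0 : ∀ i j (k l : Fin s), ¬(k.val < 4 ↔ l.val < 4) → extFlattening T (i, k) (j, l) = 0 := by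
    intro i j k l hkl
    simp [extFlattening, hT0 _ k l hkl]
  obtain ⟨a, ha⟩ := exists_eval_unflatten_eq_pow hT hf hgh
    (fun R : Matrix (Fin 3) (Fin 3) ℂ => blockDiagonal fun k : Fin s => if k.val < 4 then R else 1)
    (by simp only [ite_self]; exact blockDiagonal_one)
    (fun A B => ⟨blockDiagonal fun k : Fin s => if k.val < 4 then B else 0, fun r => by
      rw [← blockDiagonal_smul, ← blockDiagonal_add]
      congr 1
      ext k : 1
      simp only [Pi.add_apply, Pi.smul_apply]
      split_ifs <;> simp⟩) 8
    (fun R => by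
      have : (Finset.univ.filter fun k : Fin s => k.val < 4).card = 4 := by
        rw [Fin.card_filter_val_lt]; omega
      rw [det_blockDiagonal]
      simp [apply_ite det, Finset.prod_ite, this, ← pow_mul])
    (fun R i j k l => by
      have key : ∀ i j k l, ((blockDiagonal fun k : Fin s => if k.val < 4 then R else 1) *
          extFlattening T *
          (blockDiagonal fun k : Fin s => if k.val < 4 then R else 1)ᵀ) (i, k) (j, l) =
          ∑ b, ∑ a, (if k.val < 4 then R else 1) i a * (if l.val < 4 then R else 1) j b *
            extFlattening T (a, k) (b, l) := fun i j k l => by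
        simp [Matrix.mul_apply, Fintype.sum_prod_type, blockDiagonal_apply, ite_mul, mul_ite,
          Finset.sum_mul, mul_right_comm]
      simp only [key]
      by_cases hkl : k.val < 4 ↔ l.val < 4
      · rw [Finset.sum_comm, ← Finset.sum_neg_distrib]
        refine Finset.sum_congr rfl fun b _ => ?_
        rw [← Finset.sum_neg_distrib]
        refine Finset.sum_congr rfl fun a _ => ?_
        rw [extFlattening_swap T b a]
        simp only [hkl]
        ring
      · simp [hE0 _ _ _ _ hkl])
  refine ⟨a, fun r hr => ?_⟩
  have h3 := ha (fun _ => r) fun _ => hr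
  simp only [Finset.prod_const, Finset.card_univ, Fintype.card_fin] at h3
  rw [← h3]
  have : (blockDiagonal fun k : Fin s => if k.val < 4 then diagonal fun _ : Fin 3 => r else 1) =
      diagonal fun p : Fin 3 × Fin s => if p.2.val < 4 then r else 1 := by
    rw [← blockDiagonal_diagonal fun (k : Fin s) (_ : Fin 3) => if k.val < 4 then r else 1]
    congr 1
    ext k : 1
    split_ifs <;> simp
  rw [this, unflatten_diagonal_mul T _ fun k _ => if k.val < 4 then r ^ 2 else 1]
  intro m k l h
  have hkl : k.val < 4 ↔ l.val < 4 := by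
    by_contra hkl
    exact h (hT0 _ _ _ hkl)
  simp only [← hkl]
  split_ifs <;> ring

theorem eq_of_two_pow_mul {c : ℂ} (hc : c ≠ 0) {a b : ℕ} (h : c * 2 ^ a = c * 2 ^ b) : a = b := by
  have h' := mul_left_cancel₀ hc h
  exact Nat.pow_right_injective le_rfl (by exact_mod_cast h')

/-- Along the line through a block diagonal tensor, every factor of `detM s` is a monomial whose
degree is divisible by `3 * s`. -/
theorem exists_eval_smul_eq_pow_mul (hs : 4 ≤ s) (hodd : Odd s) {T : Fin 3 → Fin s → Fin s → ℂ}
    (hT : ∀ m k l, T m k l = -T m l k) (hf : (extFlattening T).det ≠ 0)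
    (hT0 : ∀ m (k l : Fin s), ¬(k.val < 4 ↔ l.val < 4) → T m k l = 0)
    {g h : MvPolynomial (Fin 3 × Fin s × Fin s) ℂ} (hgh : detM s = g * h) :
    ∃ a, 3 * s * a ≤ g.totalDegree ∧ MvPolynomial.eval (tensorCoord ((2 : ℂ) • T)) g =
      MvPolynomial.eval (tensorCoord T) g * 2 ^ (3 * s * a) := by
  have : Nonempty (Fin s) := ⟨⟨0, by omega⟩⟩
  obtain ⟨d, hd, hd'⟩ := exists_eval_smul_eq_pow hT hf hgh
  obtain ⟨w, hw⟩ := exists_eval_mul_eq_pow_card hT hf hgh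
  obtain ⟨a, ha⟩ := exists_eval_mul_eq_pow_three hs hT hf hT0 hgh
  have hg : MvPolynomial.eval (tensorCoord T) g ≠ 0 := fun h0 => hf <| by
    rw [← eval_detM hT, hgh, map_mul, h0, zero_mul]
  have hw1 : s * w = 2 * d := by
    apply eq_of_two_pow_mul hg
    have h1 := hw (fun _ => 2) fun _ => by norm_num
    have h2 := hd' (2 ^ 2)
    simp only [Finset.prod_const, Finset.card_univ, Fintype.card_fin, ← pow_mul] at h1 h2
    rw [← h1, ← h2]
    congr 2
    ext ⟨m, k, l⟩
    simp only [tensorCoord, Pi.smul_apply, smul_eq_mul]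
    ring
  have hw2 : 4 * w = 3 * a := by
    apply eq_of_two_pow_mul hg
    have hcard : (Finset.univ.filter fun k : Fin s => k.val < 4).card = 4 := by
      rw [Fin.card_filter_val_lt]; omega
    have h1 := hw (fun k => if k.val < 4 then 2 else 1) fun k => by split_ifs <;> norm_num
    have h2 := ha 2 two_ne_zero
    simp only [Finset.prod_ite, Finset.prod_const, one_pow, mul_one, hcard, ← pow_mul] at h1 h2
    rw [← h1, ← h2]
    congr 2
    ext ⟨m, k, l⟩
    by_cases hkl : k.val < 4 ↔ l.val < 4
    · simp only [tensorCoord, ← hkl]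
      split_ifs <;> ring
    · simp [tensorCoord, hT0 _ _ _ hkl]
  obtain ⟨v, rfl⟩ : 6 ∣ w := by
    have h2 : 2 ∣ w := by
      refine (Nat.Coprime.dvd_mul_left ?_).1 ⟨d, hw1⟩
      exact Nat.coprime_two_left.2 hodd
    omega
  obtain rfl : d = 3 * s * v := by linarith
  exact ⟨v, hd, hd' 2⟩

theorem totalDegree_detM_le : (detM s).totalDegree ≤ 3 * s := by
  rw [detM, det_apply]
  refine MvPolynomial.totalDegree_finsetSum_le fun σ _ => ?_
  rw [Units.smul_def, zsmul_eq_mul, ← map_intCast (MvPolynomial.C (R := ℂ)),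
    ← MvPolynomial.smul_eq_C_mul]
  refine (MvPolynomial.totalDegree_smul_le _ _).trans ?_
  refine (MvPolynomial.totalDegree_finsetProd _ _).trans ?_
  have hx : ∀ m k l, (genericSkew s m k l).totalDegree ≤ 1 := by
    intro m k l
    unfold genericSkew
    split_ifs <;> simp
  have h : ∀ p q, (extFlattening (genericSkew s) p q).totalDegree ≤ 1 := by
    intro p q
    unfold extFlattening
    split_ifs <;> simp [hx]
  exact (Finset.sum_le_card_nsmul _ _ 1 fun p _ => h _ _).trans (by simp)

theorem irreducible_detM (hs : 4 ≤ s) (hodd : Odd s) {T : Fin 3 → Fin s → Fin s → ℂ}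
    (hT : ∀ m k l, T m k l = -T m l k) (hf : (extFlattening T).det ≠ 0)
    (hT0 : ∀ m (k l : Fin s), ¬(k.val < 4 ↔ l.val < 4) → T m k l = 0) : Irreducible (detM s) := by
  have hsmul : MvPolynomial.eval (tensorCoord ((2 : ℂ) • T)) (detM s) =
      (extFlattening T).det * 2 ^ (3 * s) := by
    rw [eval_detM, extFlattening_smul, det_smul]
    · simp [mul_comm]
    · intro m k l
      rw [Pi.smul_apply, Pi.smul_apply, Pi.smul_apply, hT m k l]
      simp
  have hunit : ∀ g h : MvPolynomial (Fin 3 × Fin s × Fin s) ℂ, detM s = g * h →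
      3 * s ≤ h.totalDegree → IsUnit g := by
    intro g h hgh hdeg
    have hne : detM s ≠ 0 := fun h0 => hf <| by rw [← eval_detM hT, h0, map_zero]
    rw [hgh, mul_ne_zero_iff] at hne
    have h1 := totalDegree_detM_le (s := s)
    rw [hgh, MvPolynomial.totalDegree_mul_of_isDomain hne.1 hne.2] at h1
    have h2 : g.totalDegree = 0 := by omega
    refine MvPolynomial.isUnit_iff_totalDegree_of_isReduced.2 ⟨?_, h2⟩
    rw [MvPolynomial.totalDegree_eq_zero_iff_eq_C] at h2
    refine isUnit_iff_ne_zero.2 fun h0 => hne.1 ?_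
    rw [h2, h0, map_zero]
  refine ⟨fun hu => ?_, fun g h hgh => ?_⟩
  · have h1 := (MvPolynomial.isUnit_iff_totalDegree_of_isReduced.1 hu).2
    rw [MvPolynomial.totalDegree_eq_zero_iff_eq_C] at h1
    have h2 := eval_detM hT
    rw [h1, MvPolynomial.eval_C] at hsmul h2
    have := eq_of_two_pow_mul (a := 0) hf (by rw [← hsmul, ← h2, pow_zero, mul_one])
    omega
  · obtain ⟨a, ha, ha'⟩ := exists_eval_smul_eq_pow_mul hs hodd hT hf hT0 hgh
    obtain ⟨b, hb, hb'⟩ := exists_eval_smul_eq_pow_mul hs hodd hT hf hT0 (hgh.trans (mul_comm g h))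
    have hab : 3 * s * a + 3 * s * b = 3 * s := by
      apply eq_of_two_pow_mul hf
      rw [← hsmul, hgh, map_mul, ha', hb', ← eval_detM hT, hgh, map_mul]
      ring
    rcases Nat.eq_zero_or_pos b with rfl | hb0
    · exact .inr (hunit h g (hgh.trans (mul_comm g h)) (by omega))
    · exact .inl (hunit g h hgh ((Nat.le_mul_of_pos_right _ hb0).trans hb))

end Irreducible

section Secant

variable {s : ℕ}

theorem extFlattening_sum {ι : Type*} (S : Finset ι) (T : ι → Fin 3 → Fin s → Fin s → ℂ) :
    extFlattening (fun m k l => ∑ i ∈ S, T i m k l) = ∑ i ∈ S, extFlattening (T i) := by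
  ext ⟨i, k⟩ ⟨j, l⟩
  rw [Matrix.sum_apply]
  fin_cases i <;> fin_cases j <;> simp [extFlattening]

theorem Matrix.rank_add_le {m n : Type*} [Fintype n] [Finite m] (A B : Matrix m n ℂ) :
    (A + B).rank ≤ A.rank + B.rank := by
  rw [Matrix.rank, Matrix.mulVecLin_add]
  refine (Submodule.finrank_mono (LinearMap.range_add_le _ _)).trans ?_
  exact Submodule.finrank_add_le_finrank_add_finrank _ _

theorem Matrix.rank_sum_le {ι m n : Type*} [Fintype n] [Finite m] (S : Finset ι) (b : ℕ)
    (M : ι → Matrix m n ℂ) (h : ∀ i ∈ S, (M i).rank ≤ b) : (∑ i ∈ S, M i).rank ≤ S.card * b := by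
  classical
  induction S using Finset.induction_on with
  | empty => simp
  | insert i S hi ih =>
    rw [Finset.sum_insert hi, Finset.card_insert_of_notMem hi]
    have := Matrix.rank_add_le (M i) (∑ i ∈ S, M i)
    have := ih fun j hj => h j (by simp [hj])
    have := h i (by simp)
    lia

/-- The exterior flattening of a rank-one partially skew-symmetric tensor has rank at most four. -/
theorem rank_extFlattening_le (v : Fin 3 → ℂ) (w u : Fin s → ℂ) :
    (extFlattening fun m k l => v m * (w k * u l - w l * u k)).rank ≤ 4 := by
  let K : Matrix (Fin 3) (Fin 3) ℂ := !![0, v 0, -v 1; -v 0, 0, v 2; v 1, -v 2, 0]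
  have hK : K.rank ≤ 2 := by
    by_contra! h
    have h3 : K.rank = Fintype.card (Fin 3) :=
      le_antisymm K.rank_le_card_width (by simpa using Nat.succ_le_of_lt h)
    have hdet : K.det = 0 := by simp [K, det_fin_three]; ring
    have hsurj : Function.Surjective K.mulVec := by
      rw [← Matrix.coe_mulVecLin, ← LinearMap.range_eq_top]
      exact Submodule.eq_top_of_finrank_eq (by simpa [Matrix.rank] using h3)
    rw [Matrix.mulVec_surjective_iff_isUnit, Matrix.isUnit_iff_isUnit_det, hdet] at hsurj
    simp at hsurj
  let E : (Fin s → ℂ) → Matrix (Fin 3 × Fin s) (Fin 3) ℂ := fun w =>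
    Matrix.of fun p j => if p.1 = j then w p.2 else 0
  have e : (extFlattening fun m k l => v m * (w k * u l - w l * u k)) =
      E w * K * (E u)ᵀ + E (-u) * K * (E w)ᵀ := by
    ext ⟨i, k⟩ ⟨j, l⟩
    fin_cases i <;> fin_cases j <;>
      simp [extFlattening, E, K, Matrix.mul_apply] <;> ring
  rw [e]
  have h2 : ∀ w u, (E w * K * (E u)ᵀ).rank ≤ 2 := fun w u =>
    (rank_mul_le_left _ _).trans ((rank_mul_le_right _ _).trans hK)
  exact (Matrix.rank_add_le _ _).trans (add_le_add (h2 _ _) (h2 _ _))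

theorem det_extFlattening_eq_zero {ι : Type*} [Fintype ι] (hs : Fintype.card ι * 4 < 3 * s)
    (v : ι → Fin 3 → ℂ) (w u : ι → Fin s → ℂ) :
    (extFlattening fun m k l => ∑ i, v i m * (w i k * u i l - w i l * u i k)).det = 0 := by
  by_contra h
  have h1 := rank_of_det_ne_zero h
  rw [extFlattening_sum] at h1
  have h2 := Matrix.rank_sum_le Finset.univ 4
    (fun i => extFlattening fun m k l => v i m * (w i k * u i l - w i l * u i k))
    fun i _ => rank_extFlattening_le _ _ _
  rw [h1] at h2
  simp at h2
  lia

end Secant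

/-- For each `ℓ ≥ 1`, the determinant of the exterior flattening is irreducible and
vanishes on the secant variety `σ_{3ℓ+2}(Seg(ℙ² × 𝔾(1,4ℓ+2)))`; it generates the
prime ideal of this hypersurface. -/
theorem detM_irreducible_and_vanishes_on_secant (ℓ : ℕ) (hℓ : 1 ≤ ℓ) :
    Irreducible (detM (4 * ℓ + 3)) ∧
    ∀ (v : Fin (3 * ℓ + 2) → Fin 3 → ℂ)
      (w u : Fin (3 * ℓ + 2) → Fin (4 * ℓ + 3) → ℂ),
      MvPolynomial.eval
        (fun p : Fin 3 × Fin (4 * ℓ + 3) × Fin (4 * ℓ + 3) =>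
          ∑ i : Fin (3 * ℓ + 2),
            v i p.1 * (w i p.2.1 * u i p.2.2 - w i p.2.2 * u i p.2.1))
        (detM (4 * ℓ + 3)) = 0 := by
  refine ⟨irreducible_detM (by omega) ⟨2 * ℓ + 1, by ring⟩ (quaternionTensor_skew _)
    (det_extFlattening_quaternionTensor ℓ) fun m k l => quaternionTensor_eq_zero m,
    fun v w u => ?_⟩
  refine (eval_detM (T := fun m k l => ∑ i, v i m * (w i k * u i l - w i l * u i k)) ?_).trans
    (det_extFlattening_eq_zero (by rw [Fintype.card_fin]; omega) v w u)
  intro m k l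
  rw [← Finset.sum_neg_distrib]
  exact Finset.sum_congr rfl fun i _ => by ring
end

section
/- For every natural number s ≥ 5, the polynomial det M_s (the determinant of the ⊠-product of a generic 3×3 skew-symmetric matrix with a generic s×s skew-symmetric matrix) is irreducible in the multivariate polynomial ring R_s = MvPolynomial (Fin 3 × Fin s × Fin s) ℂ. -/
open scoped BigOperators

open MvPolynomial

namespace MvPolynomial

variable {σ R : Type*} [CommRing R]

/-- The substitution `X v ↦ z ^ w v * X v`, where `z` is a new indeterminate. -/
noncomputable def weightScale (w : σ → ℕ) : MvPolynomial σ R →ₐ[R] Polynomial (MvPolynomial σ R) :=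
  aeval fun v => Polynomial.C (X v) * Polynomial.X ^ w v

theorem weightScale_monomial (w : σ → ℕ) (e : σ →₀ ℕ) (c : R) :
    weightScale w (monomial e c) =
      Polynomial.C (monomial e c) * Polynomial.X ^ Finsupp.weight w e := by
  rw [weightScale, aeval_monomial, Finsupp.weight_apply, Finsupp.sum, Finsupp.prod,
    monomial_eq, Finsupp.prod, ← Finset.prod_pow_eq_pow_sum]
  simp only [mul_pow, Finset.prod_mul_distrib, map_mul, map_prod, map_pow, ← pow_mul,
    smul_eq_mul, mul_comm (w _), mul_assoc]
  congr 1

theorem coeff_coeff_weightScale (w : σ → ℕ) (p : MvPolynomial σ R) (e : σ →₀ ℕ) (k : ℕ) :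
    coeff e ((weightScale w p).coeff k) = if Finsupp.weight w e = k then coeff e p else 0 := by
  classical
  induction p using MvPolynomial.induction_on' with
  | monomial u c =>
    rw [weightScale_monomial, Polynomial.coeff_C_mul_X_pow]
    by_cases hu : u = e
    · subst hu
      simp [eq_comm, apply_ite (coeff u)]
    · simp [hu, apply_ite (coeff e)]
  | add p q hp hq =>
    rw [map_add, Polynomial.coeff_add, coeff_add, hp, hq, coeff_add]
    split_ifs <;> simp

theorem isWeightedHomogeneous_of_weightScale_coeff {w : σ → ℕ} {p : MvPolynomial σ R} {n : ℕ}
    (h : ∀ k, k ≠ n → (weightScale w p).coeff k = 0) : IsWeightedHomogeneous w p n := by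
  intro e he
  by_contra hne
  have := coeff_coeff_weightScale w p e (Finsupp.weight w e)
  rw [h _ hne, if_pos rfl, coeff_zero] at this
  exact he this.symm

theorem IsWeightedHomogeneous.weightScale_eq {w : σ → ℕ} {p : MvPolynomial σ R} {n : ℕ}
    (h : IsWeightedHomogeneous w p n) :
    weightScale w p = Polynomial.C p * Polynomial.X ^ n := by
  ext k e
  rw [coeff_coeff_weightScale, Polynomial.coeff_C_mul_X_pow]
  by_cases hc : coeff e p = 0
  · split_ifs <;> simp [hc]
  · rw [h hc]
    by_cases hk : n = k
    · simp [hk]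
    · simp [hk, Ne.symm hk]

theorem weightScale_ne_zero {w : σ → ℕ} {p : MvPolynomial σ R} (hp : p ≠ 0) :
    weightScale w p ≠ 0 := by
  obtain ⟨e, he⟩ := ne_zero_iff.1 hp
  intro h
  have := coeff_coeff_weightScale w p e (Finsupp.weight w e)
  rw [h, if_pos rfl] at this
  exact he (by simpa using this.symm)

/-- Over a domain, the factors of a weighted homogeneous polynomial are weighted homogeneous. -/
theorem IsWeightedHomogeneous.exists_of_mul [IsDomain R] {w : σ → ℕ} {p q : MvPolynomial σ R}
    {n : ℕ} (h : IsWeightedHomogeneous w (p * q) n) (h0 : p * q ≠ 0) :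
    ∃ a b, a + b = n ∧ IsWeightedHomogeneous w p a ∧ IsWeightedHomogeneous w q b := by
  have hp : weightScale w p ≠ 0 := weightScale_ne_zero (left_ne_zero_of_mul h0)
  have hq : weightScale w q ≠ 0 := weightScale_ne_zero (right_ne_zero_of_mul h0)
  have hpq : weightScale w p * weightScale w q = Polynomial.C (p * q) * Polynomial.X ^ n := by
    rw [← map_mul, h.weightScale_eq]
  have h1 := Polynomial.natDegree_mul hp hq
  have h2 := Polynomial.natTrailingDegree_mul hp hq
  rw [hpq, Polynomial.natDegree_C_mul_X_pow _ _ h0] at h1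
  rw [hpq, Polynomial.C_mul_X_pow_eq_monomial, Polynomial.natTrailingDegree_monomial h0] at h2
  have h3 := Polynomial.natTrailingDegree_le_natDegree (weightScale w p)
  have h4 := Polynomial.natTrailingDegree_le_natDegree (weightScale w q)
  refine ⟨_, _, h1.symm, isWeightedHomogeneous_of_weightScale_coeff fun k hk => ?_,
    isWeightedHomogeneous_of_weightScale_coeff fun k hk => ?_⟩
  all_goals
    rcases lt_or_gt_of_ne hk with hk | hk
    · exact Polynomial.coeff_eq_zero_of_lt_natTrailingDegree (by omega)
    · exact Polynomial.coeff_eq_zero_of_natDegree_lt hk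

theorem IsWeightedHomogeneous.aeval_pow_mul {S : Type*} [CommRing S] [Algebra R S] {w : σ → ℕ}
    {p : MvPolynomial σ R} {n : ℕ} (h : IsWeightedHomogeneous w p n) (z : S) (x : σ → S) :
    aeval (fun v => z ^ w v * x v) p = z ^ n * aeval x p := by
  rw [aeval_def, aeval_def, eval₂_eq, eval₂_eq, Finset.mul_sum]
  refine Finset.sum_congr rfl fun e he => ?_
  rw [← h (mem_support_iff.1 he), Finsupp.weight_apply, Finsupp.sum,
    ← Finset.prod_pow_eq_pow_sum]
  simp only [mul_pow, Finset.prod_mul_distrib, ← pow_mul, smul_eq_mul, mul_comm (w _)]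
  ring

end MvPolynomial

/-- The diagonal matrix with entries `2`, `1/2` in positions `i`, `j` is joined to the identity
by a polynomial path of matrices of determinant one. -/
theorem Matrix.exists_polynomial_path_diagonal {n : Type*} [Fintype n] [DecidableEq n] {i j : n}
    (hij : i ≠ j) :
    ∃ h : Matrix n n (Polynomial ℂ), h.det = 1 ∧ h.map (Polynomial.eval 0) = 1 ∧
      h.map (Polynomial.eval 1) =
        Matrix.diagonal fun k =>
          2 ^ Pi.single (M := fun _ => ℕ) i 1 k * (1 / 2) ^ Pi.single (M := fun _ => ℕ) j 1 k := by
  have hmap : ∀ (x : ℂ) (a b : n) (c : Polynomial ℂ),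
      (Polynomial.evalRingHom x).mapMatrix (transvection a b c) =
        transvection a b (c.eval x) := by
    intro x a b c
    rw [transvection, transvection, map_add, map_one, RingHom.mapMatrix_apply,
      Matrix.map_single _ _ _ (Polynomial.evalRingHom x)]
    rfl
  have hev : ∀ (x : ℂ) (h : Matrix n n (Polynomial ℂ)),
      h.map (Polynomial.eval x) = (Polynomial.evalRingHom x).mapMatrix h := fun _ _ => rfl
  refine ⟨transvection i j Polynomial.X * transvection j i Polynomial.X *
    transvection i j (Polynomial.C (-1 / 2) * Polynomial.X) *
    transvection j i (Polynomial.C (-2) * Polynomial.X), ?_, ?_, ?_⟩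
  · simp [hij, hij.symm]
  · simp only [hev, map_mul, hmap]
    simp
  · simp only [hev, map_mul, hmap]
    ext a b
    simp only [transvection, Matrix.mul_add, Matrix.add_mul, mul_one, one_mul,
      single_mul_single_same, Matrix.single_mul_single_of_ne _ _ _ _ hij,
      Matrix.single_mul_single_of_ne _ _ _ _ hij.symm,
      Polynomial.eval_X, Polynomial.eval_mul, Polynomial.eval_C]
    by_cases hab : a = b
    · subst hab
      by_cases hai : a = i
      · subst hai
        simp [hij, hij.symm]
        norm_num
      · by_cases haj : a = j
        · subst haj
          simp [hij]
          norm_num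
        · simp [hai, haj, Ne.symm hai, Ne.symm haj]
    · simp [hab, Matrix.single_apply]
      grind

open Matrix in
theorem extFlattening_conj {s : ℕ} {S : Type*} [CommRing S] (h : Matrix (Fin s) (Fin s) S)
    (t : Fin 3 → Matrix (Fin s) (Fin s) S) :
    extFlattening (fun m => h * t m * hᵀ) =
      kroneckerMap (· * ·) (1 : Matrix (Fin 3) (Fin 3) S) h * extFlattening (fun m => t m) *
        (kroneckerMap (· * ·) (1 : Matrix (Fin 3) (Fin 3) S) h)ᵀ := by
  ext ⟨i, x⟩ ⟨j, y⟩
  simp only [mul_apply, Fintype.sum_prod_type, kroneckerMap_apply, one_apply, transpose_apply,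
    Fin.sum_univ_three]
  fin_cases i <;> fin_cases j <;> simp [extFlattening, mul_apply]

open Matrix in
theorem det_extFlattening_conj {s : ℕ} {S : Type*} [CommRing S] (h : Matrix (Fin s) (Fin s) S)
    (t : Fin 3 → Matrix (Fin s) (Fin s) S) :
    (extFlattening (fun m => h * t m * hᵀ)).det =
      h.det ^ 6 * (extFlattening (fun m => t m)).det := by
  rw [extFlattening_conj, det_mul, det_mul, det_transpose, det_kronecker]
  simp
  ring

/-- The action of `3 × 3` matrices on triples of matrices through the exterior square. -/
def extSqAct {s : ℕ} {S : Type*} [CommRing S] (g : Matrix (Fin 3) (Fin 3) S)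
    (t : Fin 3 → Fin s → Fin s → S) : Fin 3 → Fin s → Fin s → S :=
  ![fun k l => (g 0 0 * g 1 1 - g 0 1 * g 1 0) * t 0 k l - (g 0 0 * g 1 2 - g 0 2 * g 1 0) * t 1 k l
      + (g 0 1 * g 1 2 - g 0 2 * g 1 1) * t 2 k l,
    fun k l => -(g 0 0 * g 2 1 - g 0 1 * g 2 0) * t 0 k l + (g 0 0 * g 2 2 - g 0 2 * g 2 0) * t 1 k l
      - (g 0 1 * g 2 2 - g 0 2 * g 2 1) * t 2 k l,
    fun k l => (g 1 0 * g 2 1 - g 1 1 * g 2 0) * t 0 k l - (g 1 0 * g 2 2 - g 1 2 * g 2 0) * t 1 k l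
      + (g 1 1 * g 2 2 - g 1 2 * g 2 1) * t 2 k l]

open Matrix in
theorem extFlattening_extSqAct {s : ℕ} {S : Type*} [CommRing S] (g : Matrix (Fin 3) (Fin 3) S)
    (t : Fin 3 → Fin s → Fin s → S) :
    extFlattening (extSqAct g t) =
      kroneckerMap (· * ·) g (1 : Matrix (Fin s) (Fin s) S) * extFlattening t *
        (kroneckerMap (· * ·) g (1 : Matrix (Fin s) (Fin s) S))ᵀ := by
  ext ⟨i, x⟩ ⟨j, y⟩
  simp only [mul_apply, Fintype.sum_prod_type, kroneckerMap_apply, one_apply, transpose_apply,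
    Fin.sum_univ_three]
  fin_cases i <;> fin_cases j <;> simp [extFlattening, extSqAct] <;> ring

open Matrix in
theorem det_extFlattening_extSqAct {s : ℕ} {S : Type*} [CommRing S] (g : Matrix (Fin 3) (Fin 3) S)
    (t : Fin 3 → Fin s → Fin s → S) :
    (extFlattening (extSqAct g t)).det = g.det ^ (2 * s) * (extFlattening t).det := by
  rw [extFlattening_extSqAct, det_mul, det_mul, det_transpose, det_kronecker]
  simp
  ring

/-- The row of the `m`-th nonzero block above the diagonal of an exterior flattening. -/
def blockRow : Fin 3 → Fin 3 := ![0, 0, 1]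

/-- The column of the `m`-th nonzero block above the diagonal of an exterior flattening. -/
def blockCol : Fin 3 → Fin 3 := ![1, 2, 2]

theorem extFlattening_scale {s : ℕ} {S : Type*} [CommRing S] (α : Fin 3 → S) (β : Fin s → S)
    (t : Fin 3 → Fin s → Fin s → S) :
    (extFlattening fun m k l => α (blockRow m) * α (blockCol m) * β k * β l * t m k l).det =
      ((∏ i, α i) ^ s * (∏ k, β k) ^ 3) ^ 2 * (extFlattening t).det := by
  have h1 : (extFlattening fun m k l => α (blockRow m) * α (blockCol m) * β k * β l * t m k l) =
      Matrix.of fun p q => (α p.1 * β p.2) *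
        (Matrix.of fun p q => (α q.1 * β q.2) * extFlattening t p q) p q := by
    ext ⟨i, x⟩ ⟨j, y⟩
    fin_cases i <;> fin_cases j <;> simp [extFlattening, blockRow, blockCol] <;> ring
  rw [h1, Matrix.det_mul_column, Matrix.det_mul_row, Fintype.prod_prod_type]
  simp only [Finset.prod_mul_distrib, Finset.prod_const, Finset.card_univ, Fintype.card_fin,
    Finset.prod_pow]
  ring

theorem map_det_extFlattening {s : ℕ} {R S : Type*} [CommRing R] [CommRing S] (φ : R →+* S)
    (t : Fin 3 → Fin s → Fin s → R) :
    φ (extFlattening t).det = (extFlattening fun m k l => φ (t m k l)).det := by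
  rw [RingHom.map_det]
  congr 1
  ext ⟨i, x⟩ ⟨j, y⟩
  fin_cases i <;> fin_cases j <;> simp [extFlattening]

/-- The weight on the coordinates of a tensor given by weights on its three index spaces. -/
def tensorWeight {s : ℕ} (f : Fin 3 → ℕ) (g : Fin s → ℕ) (v : Fin 3 × Fin s × Fin s) : ℕ :=
  f (blockRow v.1) + f (blockCol v.1) + g v.2.1 + g v.2.2

theorem isWeightedHomogeneous_detM {s : ℕ} (f : Fin 3 → ℕ) (g : Fin s → ℕ) :
    IsWeightedHomogeneous (tensorWeight f g) (detM s) (2 * (s * ∑ i, f i + 3 * ∑ k, g k)) := by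
  have key : weightScale (tensorWeight f g) (detM s) =
      Polynomial.C (detM s) * Polynomial.X ^ (2 * (s * ∑ i, f i + 3 * ∑ k, g k)) := by
    have h1 : ∀ m k l, weightScale (tensorWeight f g) (genericSkew s m k l) =
        Polynomial.X ^ f (blockRow m) * Polynomial.X ^ f (blockCol m) * Polynomial.X ^ g k *
          Polynomial.X ^ g l * Polynomial.C (genericSkew s m k l) := by
      intro m k l
      unfold genericSkew
      split_ifs <;> simp [weightScale, tensorWeight] <;> ring
    have h2 := map_det_extFlattening
      (weightScale (R := ℂ) (tensorWeight f g)).toRingHom (genericSkew s)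
    simp only [AlgHom.toRingHom_eq_coe, RingHom.coe_coe, h1] at h2
    rw [detM, h2, extFlattening_scale (fun i => Polynomial.X ^ f i) (fun k => Polynomial.X ^ g k),
      ← map_det_extFlattening, Finset.prod_pow_eq_pow_sum, Finset.prod_pow_eq_pow_sum]
    ring
  refine isWeightedHomogeneous_of_weightScale_coeff fun k hk => ?_
  rw [key, Polynomial.coeff_C_mul_X_pow, if_neg hk]

/-- Evaluation of polynomials in the coordinates above the diagonal at a tensor. -/
noncomputable def evalUpper {s : ℕ} {S : Type*} [CommRing S] [Algebra ℂ S]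
    (t : Fin 3 → Fin s → Fin s → S) : MvPolynomial (Fin 3 × Fin s × Fin s) ℂ →ₐ[ℂ] S :=
  aeval fun v => if v.2.1 < v.2.2 then t v.1 v.2.1 v.2.2 else 0

theorem evalUpper_detM {s : ℕ} {S : Type*} [CommRing S] [Algebra ℂ S]
    {t : Fin 3 → Fin s → Fin s → S} (ht : ∀ m k l, t m k l = -t m l k) :
    evalUpper t (detM s) = (extFlattening t).det := by
  have h := map_det_extFlattening (evalUpper t).toRingHom (genericSkew s)
  simp only [AlgHom.toRingHom_eq_coe, RingHom.coe_coe] at h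
  rw [detM, h]
  congr 2
  ext m k l
  unfold genericSkew
  split_ifs with h1 h2
  · simp [evalUpper, h1]
  · simp [evalUpper, h2, ← ht]
  · obtain rfl : k = l := le_antisymm (not_lt.1 h2) (not_lt.1 h1)
    have h3 : (2 : ℂ) • t m k k = 0 := by
      rw [two_smul]
      nth_rw 1 [ht]
      exact neg_add_cancel _
    rw [map_zero, ← one_smul ℂ (t m k k), show (1 : ℂ) = 2⁻¹ * 2 by norm_num, mul_smul, h3,
      smul_zero]

theorem map_evalUpper {s : ℕ} {S S' : Type*} [CommRing S] [Algebra ℂ S] [CommRing S']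
    [Algebra ℂ S'] (φ : S →ₐ[ℂ] S') (t : Fin 3 → Fin s → Fin s → S)
    (p : MvPolynomial (Fin 3 × Fin s × Fin s) ℂ) :
    φ (evalUpper t p) = evalUpper (fun m k l => φ (t m k l)) p := by
  rw [← AlgHom.comp_apply]
  congr 1
  apply MvPolynomial.algHom_ext
  intro v
  simp [evalUpper, apply_ite φ]

/-- A factor of `detM s` takes the same value at both ends of a polynomial path of skew tensors
along which the determinant is a nonzero constant. -/
theorem evalUpper_eq_of_path {s : ℕ} {p q : MvPolynomial (Fin 3 × Fin s × Fin s) ℂ}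
    (hpq : detM s = p * q) {t : Fin 3 → Fin s → Fin s → Polynomial ℂ}
    (ht : ∀ m k l, t m k l = -t m l k) {c : ℂ} (hc : c ≠ 0)
    (hdet : (extFlattening t).det = Polynomial.C c) (x y : ℂ) :
    evalUpper (fun m k l => (t m k l).eval x) p = evalUpper (fun m k l => (t m k l).eval y) p := by
  have h1 : evalUpper t p * evalUpper t q = Polynomial.C c := by
    rw [← map_mul, ← hpq, evalUpper_detM ht, hdet]
  have hu : IsUnit (evalUpper t p) :=
    isUnit_of_mul_isUnit_left (h1 ▸ Polynomial.isUnit_C.2 hc.isUnit)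
  obtain ⟨r, -, hr⟩ := Polynomial.isUnit_iff.1 hu
  have h2 : ∀ z, evalUpper (fun m k l => (t m k l).eval z) p = r := by
    intro z
    have := map_evalUpper (Polynomial.aeval z) t p
    simp only [Polynomial.coe_aeval_eq_eval] at this
    rw [← this, ← hr, Polynomial.eval_C]
  rw [h2, h2]

theorem evalUpper_scale {s : ℕ} {p : MvPolynomial (Fin 3 × Fin s × Fin s) ℂ} {f : Fin 3 → ℕ}
    {g : Fin s → ℕ} {n : ℕ} (h : IsWeightedHomogeneous (tensorWeight f g) p n) (z : ℂ)
    (t : Fin 3 → Fin s → Fin s → ℂ) :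
    evalUpper (fun m k l => z ^ tensorWeight f g (m, k, l) * t m k l) p =
      z ^ n * evalUpper t p := by
  rw [evalUpper, evalUpper, ← h.aeval_pow_mul z]
  congr 2
  ext v
  split_ifs <;> simp

theorem eq_of_two_pow_mul_half_pow {a b : ℕ} (h : (2 : ℂ) ^ a * (1 / 2) ^ b = 1) : a = b := by
  rw [one_div, inv_pow, mul_inv_eq_one₀ (pow_ne_zero _ two_ne_zero)] at h
  exact Nat.pow_right_injective le_rfl (by exact_mod_cast h)

/-- The weights of a factor of `detM s` for two weight functions agree, if scaling by `2` along the
first and by `1/2` along the second is realized by a path as in `evalUpper_eq_of_path`. -/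
theorem weight_eq_of_path {s : ℕ} {p q : MvPolynomial (Fin 3 × Fin s × Fin s) ℂ}
    (hpq : detM s = p * q) {t : Fin 3 → Fin s → Fin s → ℂ}
    (ht : ∀ m k l, t m k l = -t m l k) (hdet : (extFlattening t).det ≠ 0)
    {f f' : Fin 3 → ℕ} {g g' : Fin s → ℕ} {a b : ℕ}
    (ha : IsWeightedHomogeneous (tensorWeight f g) p a)
    (hb : IsWeightedHomogeneous (tensorWeight f' g') p b)
    {T : Fin 3 → Fin s → Fin s → Polynomial ℂ} (hT : ∀ m k l, T m k l = -T m l k)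
    (hTdet : (extFlattening T).det = (extFlattening fun m k l => Polynomial.C (t m k l)).det)
    (hT0 : ∀ m k l, (T m k l).eval 0 = t m k l)
    (hT1 : ∀ m k l, (T m k l).eval 1 = 2 ^ tensorWeight f g (m, k, l) *
      ((1 / 2) ^ tensorWeight f' g' (m, k, l) * t m k l)) : a = b := by
  have h1 := evalUpper_eq_of_path hpq hT hdet
    (hTdet.trans (map_det_extFlattening Polynomial.C t).symm) 1 0
  simp only [hT0, hT1] at h1
  rw [evalUpper_scale ha, evalUpper_scale hb, ← mul_assoc] at h1
  have h2 : evalUpper t p ≠ 0 := by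
    intro h
    rw [← evalUpper_detM ht, hpq, map_mul, h, zero_mul] at hdet
    exact hdet rfl
  exact eq_of_two_pow_mul_half_pow (mul_right_cancel₀ h2 (h1.trans (one_mul _).symm))

open Matrix in
theorem index_weight_eq {s : ℕ} {p q : MvPolynomial (Fin 3 × Fin s × Fin s) ℂ}
    (hpq : detM s = p * q) {t : Fin 3 → Fin s → Fin s → ℂ}
    (ht : ∀ m k l, t m k l = -t m l k) (hdet : (extFlattening t).det ≠ 0) {i j : Fin s} {a b : ℕ}
    (ha : IsWeightedHomogeneous (tensorWeight 0 (Pi.single i 1)) p a)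
    (hb : IsWeightedHomogeneous (tensorWeight 0 (Pi.single j 1)) p b) : a = b := by
  obtain rfl | hij := eq_or_ne i j
  · have h0 : p ≠ 0 := by
      rintro rfl
      rw [← evalUpper_detM ht, hpq] at hdet
      simp at hdet
    exact ha.inj_right h0 hb
  obtain ⟨h, hh, h0, h1⟩ := Matrix.exists_polynomial_path_diagonal hij
  have hev : ∀ x m k l, ((h * (of (t m)).map Polynomial.C * hᵀ) k l).eval x =
      (h.map (Polynomial.eval x) * of (t m) * (h.map (Polynomial.eval x))ᵀ) k l := by
    intro x m k l
    simp [mul_apply, Polynomial.eval_finsetSum]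
  refine weight_eq_of_path hpq ht hdet ha hb
    (T := fun m => h * (of (t m)).map Polynomial.C * hᵀ) ?_ ?_ ?_ ?_
  · intro m k l
    have h2 : ((of (t m)).map Polynomial.C)ᵀ = -(of (t m)).map Polynomial.C := by
      ext1 x y
      simp [ht m y x]
    have h3 : (h * (of (t m)).map Polynomial.C * hᵀ)ᵀ =
        -(h * (of (t m)).map Polynomial.C * hᵀ) := by
      rw [transpose_mul, transpose_mul, transpose_transpose, h2]
      simp [Matrix.mul_assoc]
    have := congrFun (congrFun h3 l) k
    simpa using this
  · rw [det_extFlattening_conj, hh, one_pow, one_mul]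
    rfl
  · intro m k l
    rw [hev, h0]
    simp
  · intro m k l
    rw [hev, h1]
    simp [tensorWeight, pow_add]
    ring

theorem block_weight_eq {s : ℕ} {p q : MvPolynomial (Fin 3 × Fin s × Fin s) ℂ}
    (hpq : detM s = p * q) {t : Fin 3 → Fin s → Fin s → ℂ}
    (ht : ∀ m k l, t m k l = -t m l k) (hdet : (extFlattening t).det ≠ 0) {i j : Fin 3} {a b : ℕ}
    (ha : IsWeightedHomogeneous (tensorWeight (Pi.single i 1) 0) p a)
    (hb : IsWeightedHomogeneous (tensorWeight (Pi.single j 1) 0) p b) : a = b := by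
  obtain rfl | hij := eq_or_ne i j
  · have h0 : p ≠ 0 := by
      rintro rfl
      rw [← evalUpper_detM ht, hpq] at hdet
      simp at hdet
    exact ha.inj_right h0 hb
  obtain ⟨h, hh, h0, h1⟩ := Matrix.exists_polynomial_path_diagonal hij
  have hev : ∀ x m k l, (extSqAct h (fun m k l => Polynomial.C (t m k l)) m k l).eval x =
      extSqAct (h.map (Polynomial.eval x)) t m k l := by
    intro x m k l
    fin_cases m <;> simp [extSqAct]
  have hdiag : ∀ (d : Fin 3 → ℂ) m k l, extSqAct (Matrix.diagonal d) t m k l =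
      d (blockRow m) * d (blockCol m) * t m k l := by
    intro d m k l
    fin_cases m <;> simp [extSqAct, blockRow, blockCol]
  refine weight_eq_of_path hpq ht hdet ha hb
    (T := extSqAct h fun m k l => Polynomial.C (t m k l)) ?_ ?_ ?_ ?_
  · intro m k l
    fin_cases m <;> simp [extSqAct, ht _ k l] <;> ring
  · rw [det_extFlattening_extSqAct, hh, one_pow, one_mul]
  · intro m k l
    rw [hev, h0, ← Matrix.diagonal_one, hdiag]
    simp
  · intro m k l
    rw [hev, h1, hdiag]
    simp only [tensorWeight, pow_add, Pi.zero_apply]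
    ring

/-- The numbers `a`, `d` are admissible if every skew tensor with nonvanishing determinant supports
an exponent vector (on the coordinates above the diagonal) whose index weights are all `a` and
whose degree in each slice is `d`. -/
def Admissible (s a d : ℕ) : Prop :=
  ∀ t : Fin 3 → Fin s → Fin s → ℂ, (∀ m k l, t m k l = -t m l k) → (extFlattening t).det ≠ 0 →
    ∃ e : Fin 3 → Fin s → Fin s → ℕ, (∀ m k l, e m k l ≠ 0 → k < l ∧ t m k l ≠ 0) ∧
      (∀ i, ∑ m, ∑ k, (e m i k + e m k i) = a) ∧ ∀ m, ∑ k, ∑ l, e m k l = d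

theorem exists_mem_support_of_evalUpper_ne_zero {s : ℕ}
    {p : MvPolynomial (Fin 3 × Fin s × Fin s) ℂ} {t : Fin 3 → Fin s → Fin s → ℂ}
    (h : evalUpper t p ≠ 0) :
    ∃ e, coeff e p ≠ 0 ∧ ∀ m k l, e (m, k, l) ≠ 0 → k < l ∧ t m k l ≠ 0 := by
  rw [evalUpper, aeval_def, eval₂_eq] at h
  obtain ⟨e, he, hne⟩ := Finset.exists_ne_zero_of_sum_ne_zero h
  refine ⟨e, mem_support_iff.1 he, fun m k l hv => ?_⟩
  have := Finset.prod_ne_zero_iff.1 (right_ne_zero_of_mul hne) (m, k, l)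
    (Finsupp.mem_support_iff.2 hv)
  have := (pow_ne_zero_iff hv).1 this
  by_contra hcon
  apply this
  by_cases hkl : k < l
  · simpa [hkl] using hcon
  · simp [hkl]

theorem weight_tensorWeight {s : ℕ} (f : Fin 3 → ℕ) (g : Fin s → ℕ)
    (e : Fin 3 × Fin s × Fin s →₀ ℕ) :
    Finsupp.weight (tensorWeight f g) e =
      ∑ m, ∑ k, ∑ l, e (m, k, l) * tensorWeight f g (m, k, l) := by
  rw [Finsupp.weight_apply, Finsupp.sum_fintype _ _ (by simp), Fintype.sum_prod_type]
  simp only [Fintype.sum_prod_type, smul_eq_mul]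

theorem weight_tensorWeight_index {s : ℕ} (i : Fin s) (e : Fin 3 × Fin s × Fin s →₀ ℕ) :
    Finsupp.weight (tensorWeight 0 (Pi.single i 1)) e =
      ∑ m, ∑ k, (e (m, i, k) + e (m, k, i)) := by
  rw [weight_tensorWeight]
  refine Finset.sum_congr rfl fun m _ => ?_
  simp [tensorWeight, mul_add, Finset.sum_add_distrib, Pi.single_apply]

theorem weight_tensorWeight_block {s : ℕ} (i : Fin 3) (e : Fin 3 × Fin s × Fin s →₀ ℕ) :
    Finsupp.weight (tensorWeight (Pi.single i 1) 0) e =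
      ∑ m, (∑ k, ∑ l, e (m, k, l)) *
        (Pi.single (M := fun _ => ℕ) i 1 (blockRow m) +
          Pi.single (M := fun _ => ℕ) i 1 (blockCol m)) := by
  rw [weight_tensorWeight]
  refine Finset.sum_congr rfl fun m _ => ?_
  simp [tensorWeight, Finset.sum_mul]

theorem exists_index_weight {s : ℕ} (hs : 0 < s) {p q : MvPolynomial (Fin 3 × Fin s × Fin s) ℂ}
    (hpq : detM s = p * q) {t : Fin 3 → Fin s → Fin s → ℂ}
    (ht : ∀ m k l, t m k l = -t m l k) (hdet : (extFlattening t).det ≠ 0) :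
    ∃ a b, a + b = 6 ∧ (∀ i, IsWeightedHomogeneous (tensorWeight 0 (Pi.single i 1)) p a) ∧
      ∀ i, IsWeightedHomogeneous (tensorWeight 0 (Pi.single i 1)) q b := by
  have h0 : p * q ≠ 0 := by
    intro h
    rw [← evalUpper_detM ht, hpq, h, map_zero] at hdet
    exact hdet rfl
  have h : ∀ i : Fin s, ∃ a b, a + b = 6 ∧
      IsWeightedHomogeneous (tensorWeight 0 (Pi.single i 1)) p a ∧
      IsWeightedHomogeneous (tensorWeight 0 (Pi.single i 1)) q b := by
    intro i
    have := isWeightedHomogeneous_detM (s := s) 0 (Pi.single i 1)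
    simp only [Pi.zero_apply, Finset.sum_const_zero, mul_zero, zero_add, Finset.sum_pi_single',
      Finset.mem_univ, if_true] at this
    rw [hpq] at this
    simpa using this.exists_of_mul h0
  choose a b hab hp hq using h
  refine ⟨a ⟨0, hs⟩, b ⟨0, hs⟩, hab _, fun i => ?_, fun i => ?_⟩
  · rw [index_weight_eq hpq ht hdet (hp ⟨0, hs⟩) (hp i)]
    exact hp i
  · rw [index_weight_eq (hpq.trans (mul_comm _ _)) ht hdet (hq ⟨0, hs⟩) (hq i)]
    exact hq i

theorem exists_admissible {s : ℕ} {p q : MvPolynomial (Fin 3 × Fin s × Fin s) ℂ}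
    (hpq : detM s = p * q) {t : Fin 3 → Fin s → Fin s → ℂ}
    (ht : ∀ m k l, t m k l = -t m l k) (hdet : (extFlattening t).det ≠ 0) {a : ℕ}
    (ha : ∀ i, IsWeightedHomogeneous (tensorWeight 0 (Pi.single i 1)) p a) :
    ∃ d, Admissible s a d := by
  have h0 : p * q ≠ 0 := by
    intro h
    rw [← evalUpper_detM ht, hpq, h, map_zero] at hdet
    exact hdet rfl
  have h : ∀ i, ∃ c, IsWeightedHomogeneous (tensorWeight (s := s) (Pi.single i 1) 0) p c := by
    intro i
    have := isWeightedHomogeneous_detM (s := s) (Pi.single i 1) 0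
    rw [hpq] at this
    obtain ⟨c, -, -, hc, -⟩ := this.exists_of_mul h0
    exact ⟨c, hc⟩
  choose c hc using h
  refine ⟨c 0 / 2, fun t ht hdet => ?_⟩
  have h1 : evalUpper t p ≠ 0 := by
    intro h
    rw [← evalUpper_detM ht, hpq, map_mul, h, zero_mul] at hdet
    exact hdet rfl
  obtain ⟨e, he, hsupp⟩ := exists_mem_support_of_evalUpper_ne_zero h1
  refine ⟨fun m k l => e (m, k, l), hsupp, fun i => ?_, ?_⟩
  · rw [← weight_tensorWeight_index, ha i he]
  · have e0 := hc 0 he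
    have e1 := hc 1 he
    have e2 := hc 2 he
    rw [← block_weight_eq hpq ht hdet (hc 0) (hc 1)] at e1
    rw [← block_weight_eq hpq ht hdet (hc 0) (hc 2)] at e2
    rw [weight_tensorWeight_block, Fin.sum_univ_three] at e0 e1 e2
    simp [blockRow, blockCol] at e0 e1 e2
    intro m
    fin_cases m <;> simp <;> omega

theorem Admissible.mul_eq {s a d : ℕ} (h : Admissible s a d)
    {t : Fin 3 → Fin s → Fin s → ℂ} (ht : ∀ m k l, t m k l = -t m l k)
    (hdet : (extFlattening t).det ≠ 0) : s * a = 6 * d := by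
  obtain ⟨e, -, h1, h2⟩ := h t ht hdet
  have h3 : ∑ i, ∑ m, ∑ k, (e m i k + e m k i) = s * a := by simp [h1]
  have h4 : ∑ m, ∑ k, ∑ l, e m k l = 3 * d := by simp [h2]
  rw [← h3, Finset.sum_comm]
  simp only [Finset.sum_add_distrib]
  have h5 : ∑ m, ∑ k, ∑ l, e m l k = 3 * d := by
    rw [← h4]
    exact Finset.sum_congr rfl fun m _ => Finset.sum_comm
  rw [h4, h5]
  ring

/-- The tensor with entries `1` (and, by skew-symmetry, `-1`) at the listed positions. -/
def edgeTensor {s : ℕ} (L : List (Fin 3 × Fin s × Fin s)) (m : Fin 3) (k l : Fin s) : ℤ :=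
  (if (m, k, l) ∈ L then 1 else 0) - if (m, l, k) ∈ L then 1 else 0

theorem edgeTensor_skew {s : ℕ} (L : List (Fin 3 × Fin s × Fin s)) (m : Fin 3) (k l : Fin s) :
    (edgeTensor L m k l : ℂ) = -edgeTensor L m l k := by
  simp [edgeTensor]

/-- The square matrix with the listed entries, the remaining ones being zero. -/
def sparseMatrix {n : ℕ} (L : List (Fin 3 × Fin n × Fin 3 × Fin n × ℤ)) :
    Matrix (Fin 3 × Fin n) (Fin 3 × Fin n) ℤ := fun p q =>
  (L.map fun x => if (x.1, x.2.1) = p ∧ (x.2.2.1, x.2.2.2.1) = q then x.2.2.2.2 else 0).sum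

theorem det_edgeTensor_ne_zero {s : ℕ} (L : List (Fin 3 × Fin s × Fin s))
    (N : Matrix (Fin 3 × Fin s) (Fin 3 × Fin s) ℤ) {c : ℤ} (hc : c ≠ 0)
    (h : ∀ p q, (extFlattening (edgeTensor L) * N) p q = if p = q then c else 0) :
    (extFlattening fun m k l => (edgeTensor L m k l : ℂ)).det ≠ 0 := by
  have h1 : extFlattening (edgeTensor L) * N = Matrix.diagonal fun _ => c := by
    ext p q
    rw [h, Matrix.diagonal_apply]
  have h2 := congrArg Matrix.det h1
  rw [Matrix.det_mul, Matrix.det_diagonal, Finset.prod_const] at h2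
  have h3 : (extFlattening (edgeTensor L)).det ≠ 0 := by
    intro h0
    rw [h0, zero_mul] at h2
    exact pow_ne_zero _ hc h2.symm
  have h4 := map_det_extFlattening (Int.castRingHom ℂ) (edgeTensor L)
  simp only [eq_intCast] at h4
  rw [← h4]
  exact_mod_cast h3

/-- The direct sum of two tensors along the two skew-symmetric index spaces. -/
def blockSum {s r : ℕ} {R : Type*} [Zero R] (t : Fin 3 → Fin s → Fin s → R)
    (u : Fin 3 → Fin r → Fin r → R) (m : Fin 3) (k l : Fin (s + r)) : R :=
  Matrix.fromBlocks (.of (t m)) 0 0 (.of (u m)) (finSumFinEquiv.symm k) (finSumFinEquiv.symm l)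

theorem det_extFlattening_blockSum {s r : ℕ} {R : Type*} [CommRing R]
    (t : Fin 3 → Fin s → Fin s → R) (u : Fin 3 → Fin r → Fin r → R) :
    (extFlattening (blockSum t u)).det = (extFlattening t).det * (extFlattening u).det := by
  rw [← Matrix.det_fromBlocks_zero₂₁ (extFlattening t) 0 (extFlattening u),
    ← Matrix.det_reindex_self
      (((Equiv.refl (Fin 3)).prodCongr finSumFinEquiv.symm).trans (Equiv.prodSumDistrib _ _ _))]
  congr 1
  ext x y
  rcases x with ⟨i, x⟩ | ⟨i, x⟩ <;> rcases y with ⟨j, y⟩ | ⟨j, y⟩ <;>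
    simp [extFlattening, blockSum, Equiv.prodSumDistrib]

theorem blockSum_skew {s r : ℕ} {R : Type*} [CommRing R]
    {t : Fin 3 → Fin s → Fin s → R} {u : Fin 3 → Fin r → Fin r → R}
    (ht : ∀ m k l, t m k l = -t m l k) (hu : ∀ m k l, u m k l = -u m l k) (m : Fin 3)
    (k l : Fin (s + r)) : blockSum t u m k l = -blockSum t u m l k := by
  unfold blockSum
  rcases finSumFinEquiv.symm k with k | k <;> rcases finSumFinEquiv.symm l with l | l <;>
    simp [← ht, ← hu]

/-- A tensor of size 3 with nonvanishing determinant. -/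
def edges3 : List (Fin 3 × Fin 3 × Fin 3) :=
  [(0, 0, 1), (1, 0, 2), (2, 1, 2)]

set_option maxRecDepth 20000 in
theorem det_edges3_ne_zero :
    (extFlattening fun m k l => (edgeTensor edges3 m k l : ℂ)).det ≠ 0 :=
  det_edgeTensor_ne_zero _ (c := 2) (sparseMatrix
    [(0, 0, 0, 0, 1), (0, 0, 1, 1, 1), (0, 0, 2, 2, -1), (0, 1, 1, 0, -2), (0, 2, 2, 0, 2), (1, 0, 0, 1, -2),
      (1, 1, 0, 0, 1), (1, 1, 1, 1, 1), (1, 1, 2, 2, 1), (1, 2, 2, 1, -2), (2, 0, 0, 2, 2), (2, 1, 1, 2, -2),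
      (2, 2, 0, 0, -1), (2, 2, 1, 1, 1), (2, 2, 2, 2, 1)])
    (by decide) (by decide +kernel)

/-- A tensor of size 4 with nonvanishing determinant. -/
def edges4 : List (Fin 3 × Fin 4 × Fin 4) :=
  [(0, 0, 3), (0, 1, 2), (1, 0, 2), (2, 1, 3)]

set_option maxRecDepth 20000 in
theorem det_edges4_ne_zero :
    (extFlattening fun m k l => (edgeTensor edges4 m k l : ℂ)).det ≠ 0 :=
  det_edgeTensor_ne_zero _ (c := 1) (sparseMatrix
    [(0, 0, 2, 2, -1), (0, 1, 1, 2, 1), (0, 2, 2, 0, 1), (0, 3, 1, 0, -1), (1, 0, 0, 3, -1), (1, 1, 2, 3, 1),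
      (1, 2, 0, 1, 1), (1, 3, 2, 1, -1), (2, 0, 0, 2, 1), (2, 0, 2, 3, 1), (2, 1, 1, 3, -1), (2, 1, 2, 2, -1),
      (2, 2, 0, 0, -1), (2, 2, 2, 1, -1), (2, 3, 1, 1, 1), (2, 3, 2, 0, 1)])
    (by decide) (by decide +kernel)

/-- A tensor of size 5 with nonvanishing determinant. -/
def edges5 : List (Fin 3 × Fin 5 × Fin 5) :=
  [(0, 1, 3), (0, 2, 4), (1, 0, 4), (1, 2, 3), (2, 0, 1), (2, 3, 4)]

set_option maxRecDepth 20000 in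
theorem det_edges5_ne_zero :
    (extFlattening fun m k l => (edgeTensor edges5 m k l : ℂ)).det ≠ 0 :=
  det_edgeTensor_ne_zero _ (c := 2) (sparseMatrix
    [(0, 0, 0, 1, 2), (0, 0, 2, 4, -2), (0, 1, 0, 0, 2), (0, 1, 1, 3, 2), (0, 2, 0, 2, -1), (0, 2, 1, 4, 1),
      (0, 2, 2, 3, -1), (0, 3, 2, 2, 2), (0, 4, 1, 2, -2), (1, 0, 2, 1, 2), (1, 1, 1, 2, -2), (1, 1, 2, 0, -2),
      (1, 2, 0, 4, -2), (1, 2, 1, 1, -2), (1, 2, 2, 2, -2), (1, 3, 0, 1, 2), (1, 4, 0, 2, 1), (1, 4, 1, 4, -1),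
      (1, 4, 2, 3, -1), (2, 0, 1, 1, -2), (2, 0, 2, 2, -2), (2, 1, 1, 0, 2), (2, 2, 0, 3, 2), (2, 2, 1, 2, -2),
      (2, 2, 2, 0, -2), (2, 3, 0, 2, -1), (2, 3, 1, 4, -1), (2, 3, 2, 3, -1), (2, 4, 0, 0, -2)])
    (by decide) (by decide +kernel)

/-- A tensor of size 6 with nonvanishing determinant. -/
def edges6 : List (Fin 3 × Fin 6 × Fin 6) :=
  [(0, 0, 3), (0, 2, 5), (1, 1, 4), (1, 2, 5), (2, 0, 4), (2, 1, 5), (2, 2, 3)]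

set_option maxRecDepth 20000 in
theorem det_edges6_ne_zero :
    (extFlattening fun m k l => (edgeTensor edges6 m k l : ℂ)).det ≠ 0 :=
  det_edgeTensor_ne_zero _ (c := 1) (sparseMatrix
    [(0, 0, 0, 5, 1), (0, 0, 1, 3, 1), (0, 0, 2, 3, 1), (0, 1, 0, 3, -1), (0, 1, 2, 4, -1), (0, 2, 0, 4, 1),
      (0, 2, 1, 5, 1), (0, 3, 0, 1, -1), (0, 3, 1, 0, -1), (0, 4, 0, 2, 1), (0, 4, 1, 1, 1), (0, 4, 2, 1, 1),
      (0, 5, 0, 0, 1), (0, 5, 2, 2, 1), (1, 0, 0, 3, -1), (1, 1, 0, 4, 1), (1, 1, 1, 5, 1), (1, 1, 2, 5, 1),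
      (1, 2, 2, 3, 1), (1, 3, 0, 0, 1), (1, 4, 2, 0, -1), (1, 5, 0, 2, 1), (1, 5, 1, 1, 1), (2, 0, 1, 4, -1),
      (2, 1, 0, 4, 1), (2, 2, 0, 5, 1), (2, 2, 2, 3, 1), (2, 3, 0, 0, 1), (2, 3, 1, 2, 1), (2, 3, 2, 2, 1),
      (2, 4, 0, 1, -1), (2, 5, 1, 1, 1)])
    (by decide) (by decide +kernel)

theorem edgeTensor_mem_of_ne_zero {s : ℕ} {L : List (Fin 3 × Fin s × Fin s)}
    (hL : ∀ v ∈ L, v.2.1 < v.2.2) {m : Fin 3} {k l : Fin s} (hkl : k < l)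
    (h : (edgeTensor L m k l : ℂ) ≠ 0) : (m, k, l) ∈ L := by
  by_contra hn
  have h1 : (m, l, k) ∉ L := fun hm => lt_asymm hkl (hL _ hm)
  simp [edgeTensor, hn, h1] at h

theorem Admissible.of_add_three {s a d : ℕ} (h : Admissible (s + 3) a d)
    {t : Fin 3 → Fin s → Fin s → ℂ} (ht : ∀ m k l, t m k l = -t m l k)
    (hdet : (extFlattening t).det ≠ 0) : Even a ∧ Admissible s a (d - a / 2) := by
  have key : ∀ t : Fin 3 → Fin s → Fin s → ℂ, (∀ m k l, t m k l = -t m l k) →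
      (extFlattening t).det ≠ 0 → Even a ∧
      ∃ e : Fin 3 → Fin s → Fin s → ℕ, (∀ m k l, e m k l ≠ 0 → k < l ∧ t m k l ≠ 0) ∧
      (∀ i, ∑ m, ∑ k, (e m i k + e m k i) = a) ∧ ∀ m, ∑ k, ∑ l, e m k l = d - a / 2 := by
    intro t ht hdet
    obtain ⟨e, hsupp, hi, hb⟩ := h
      (blockSum t fun m k l => (edgeTensor edges3 m k l : ℂ))
      (blockSum_skew ht (edgeTensor_skew _))
      (by rw [det_extFlattening_blockSum]; exact mul_ne_zero hdet det_edges3_ne_zero)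
    have hlr : ∀ m k l, e m (Fin.castAdd 3 k) (Fin.natAdd s l) = 0 := by
      intro m k l
      by_contra hne
      simpa [blockSum] using (hsupp _ _ _ hne).2
    have hrl : ∀ m k l, e m (Fin.natAdd s k) (Fin.castAdd 3 l) = 0 := by
      intro m k l
      by_contra hne
      simpa [blockSum] using (hsupp _ _ _ hne).2
    have hrr : ∀ m k l, (m, k, l) ∉ edges3 → e m (Fin.natAdd s k) (Fin.natAdd s l) = 0 := by
      intro m k l hn
      by_contra hne
      obtain ⟨h1, h2⟩ := hsupp _ _ _ hne
      refine hn (edgeTensor_mem_of_ne_zero (by decide) ?_ (by simpa [blockSum] using h2))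
      simpa using h1
    have hi0 := hi (Fin.natAdd s 0)
    have hi1 := hi (Fin.natAdd s 1)
    have hi2 := hi (Fin.natAdd s 2)
    have hb0 := hb 0
    have hb1 := hb 1
    have hb2 := hb 2
    simp only [Fin.sum_univ_add, hlr, hrl, Finset.sum_const_zero, Fin.sum_univ_three, zero_add,
      add_zero] at hi0 hi1 hi2 hb0 hb1 hb2
    simp (disch := decide) only [hrr, zero_add, add_zero] at hi0 hi1 hi2 hb0 hb1 hb2
    refine ⟨⟨e 0 (Fin.natAdd s 0) (Fin.natAdd s 1), by omega⟩,
      fun m k l => e m (Fin.castAdd 3 k) (Fin.castAdd 3 l), fun m k l hne => ?_, fun i => ?_, ?_⟩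
    · obtain ⟨h1, h2⟩ := hsupp _ _ _ hne
      exact ⟨h1, by simpa [blockSum] using h2⟩
    · have := hi (Fin.castAdd 3 i)
      simpa [Fin.sum_univ_add, hlr, hrl] using this
    · intro m
      fin_cases m <;> dsimp only [Fin.zero_eta, Fin.mk_one, Fin.reduceFinMk] <;> omega
  exact ⟨(key t ht hdet).1, fun t ht hdet => (key t ht hdet).2⟩

theorem exists_det_ne_zero (s : ℕ) (hs : 3 ≤ s) :
    ∃ t : Fin 3 → Fin s → Fin s → ℂ, (∀ m k l, t m k l = -t m l k) ∧
      (extFlattening t).det ≠ 0 := by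
  induction s using Nat.strong_induction_on with
  | _ s ih =>
    by_cases h6 : 6 ≤ s
    · obtain ⟨r, rfl⟩ := Nat.exists_eq_add_of_le' (show 3 ≤ s by omega)
      obtain ⟨t, ht, hdet⟩ := ih r (by omega) (by omega)
      refine ⟨blockSum t fun m k l => (edgeTensor edges3 m k l : ℂ),
        blockSum_skew ht (edgeTensor_skew _), ?_⟩
      rw [det_extFlattening_blockSum]
      exact mul_ne_zero hdet det_edges3_ne_zero
    · obtain rfl | rfl | rfl : s = 3 ∨ s = 4 ∨ s = 5 := by omega
      · exact ⟨_, edgeTensor_skew _, det_edges3_ne_zero⟩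
      · exact ⟨_, edgeTensor_skew _, det_edges4_ne_zero⟩
      · exact ⟨_, edgeTensor_skew _, det_edges5_ne_zero⟩

theorem Admissible.three_dvd {a d : ℕ} (h : Admissible 6 a d) : 3 ∣ a := by
  obtain ⟨e, hsupp, hi, hb⟩ := h _ (edgeTensor_skew _) det_edges6_ne_zero
  have hz : ∀ m k l, (m, k, l) ∉ edges6 → e m k l = 0 := by
    intro m k l hn
    by_contra hne
    obtain ⟨h1, h2⟩ := hsupp _ _ _ hne
    exact hn (edgeTensor_mem_of_ne_zero (by decide) h1 h2)
  have hi0 := hi 0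
  have hi1 := hi 1
  have hi2 := hi 2
  have hi3 := hi 3
  have hi4 := hi 4
  have hi5 := hi 5
  have hb0 := hb 0
  have hb1 := hb 1
  have hb2 := hb 2
  simp only [Fin.sum_univ_three, Fin.sum_univ_six] at hi0 hi1 hi2 hi3 hi4 hi5 hb0 hb1 hb2
  simp (disch := decide) only [hz, zero_add, add_zero] at hi0 hi1 hi2 hi3 hi4 hi5 hb0 hb1 hb2
  omega

theorem Admissible.six_dvd {s a d : ℕ} (hs : 5 ≤ s) (h : Admissible s a d) : 6 ∣ a := by
  induction s using Nat.strong_induction_on generalizing d with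
  | _ s ih =>
    by_cases h6 : 6 ≤ s
    · obtain ⟨r, rfl⟩ := Nat.exists_eq_add_of_le' (show 3 ≤ s by omega)
      obtain ⟨t, ht, hdet⟩ := exists_det_ne_zero r (by omega)
      obtain ⟨heven, hr⟩ := h.of_add_three ht hdet
      by_cases h8 : 5 ≤ r
      · exact ih r (by omega) h8 hr
      · obtain rfl | rfl : r = 3 ∨ r = 4 := by omega
        · have := h.three_dvd
          have := heven.two_dvd
          omega
        · have := hr.mul_eq ht hdet
          have := heven.two_dvd
          omega
    · obtain rfl : s = 5 := by omega
      have := h.mul_eq (edgeTensor_skew _) det_edges5_ne_zero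
      omega

theorem isUnit_of_index_weight_zero {s : ℕ} {p : MvPolynomial (Fin 3 × Fin s × Fin s) ℂ}
    (hp : p ≠ 0) (h : ∀ i, IsWeightedHomogeneous (tensorWeight 0 (Pi.single i 1)) p 0) :
    IsUnit p := by
  have h1 : ∀ e, coeff e p ≠ 0 → e = 0 := by
    intro e he
    ext ⟨m, k, l⟩
    have := h k he
    rw [weight_tensorWeight_index] at this
    simp only [Finset.sum_eq_zero_iff, Finset.mem_univ, true_imp_iff, add_eq_zero] at this
    exact (this m l).1
  have h2 : p = C (coeff 0 p) := by
    ext e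
    rw [coeff_C]
    split_ifs with he
    · rw [he]
    · by_contra hne
      exact he (h1 e hne).symm
  rw [h2]
  refine (isUnit_iff_ne_zero.2 fun h0 => hp ?_).map C
  rw [h2, h0, C_0]

/-- For every `s ≥ 5`, the determinant of the ⊠-product of a generic `3×3`
skew-symmetric matrix with a generic `s×s` skew-symmetric matrix is irreducible. -/
theorem detM_irreducible_of_five_le (s : ℕ) (hs : 5 ≤ s) : Irreducible (detM s) := by
  obtain ⟨t, ht, hdet⟩ := exists_det_ne_zero s (by omega)
  have hne : detM s ≠ 0 := by
    intro h
    rw [← evalUpper_detM ht, h, map_zero] at hdet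
    exact hdet rfl
  refine ⟨fun hu => ?_, fun p q hpq => ?_⟩
  · obtain ⟨c, -, hc⟩ := isUnit_iff_eq_C_of_isReduced.1 hu
    have h1 := isWeightedHomogeneous_detM (s := s) 0 1
    have h2 := isWeightedHomogeneous_C (tensorWeight (s := s) 0 1) c
    rw [← hc] at h2
    have := h1.inj_right hne h2
    simp at this
    omega
  · obtain ⟨a, b, hab, ha, hb⟩ := exists_index_weight (by omega) hpq ht hdet
    obtain ⟨d, hd⟩ := exists_admissible hpq ht hdet ha
    have h6 := hd.six_dvd hs
    rw [hpq] at hne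
    obtain rfl | rfl : a = 0 ∨ b = 0 := by omega
    · exact Or.inl (isUnit_of_index_weight_zero (left_ne_zero_of_mul hne) ha)
    · exact Or.inr (isUnit_of_index_weight_zero (right_ne_zero_of_mul hne) hb)
end

section
/- For s = 3, the determinant det M_3 of the ⊠-product of a generic 3×3 skew-symmetric matrix with a generic 3×3 skew-symmetric matrix is the cube of a cubic polynomial: there exists c in R_3 with total degree of c equal to 3 and det M_3 = c³. -/
open scoped BigOperators

/-- The matrix whose rows are the axial vectors of the `3 × 3` slices `t 2`, `t 1`, `t 0`. -/
def axialMatrix {R : Type*} (t : Fin 3 → Fin 3 → Fin 3 → R) : Matrix (Fin 3) (Fin 3) R :=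
  !![t 2 1 2, t 2 2 0, t 2 0 1; t 1 1 2, t 1 2 0, t 1 0 1; t 0 1 2, t 0 2 0, t 0 0 1]

/-- The polarization of the second elementary symmetric function of a `3 × 3` matrix, as a
symmetric matrix. -/
def minorSumMatrix (R : Type*) [CommRing R] : Matrix (Fin 3 × Fin 3) (Fin 3 × Fin 3) R :=
  fun p q => (if p.1 = p.2 then 1 else 0) * (if q.1 = q.2 then 1 else 0) -
    (if p.1 = q.2 then 1 else 0) * (if p.2 = q.1 then 1 else 0)

open Matrix in
theorem det_minorSumMatrix (R : Type*) [CommRing R] : (minorSumMatrix R).det = -2 := by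
  let v : Fin 3 × Fin 3 → R := fun p => if p.1 = p.2 then 1 else 0
  let e : Equiv.Perm (Fin 3 × Fin 3) := Equiv.prodComm _ _
  have hfac : minorSumMatrix R =
      -((1 + replicateCol Unit (-v) * replicateRow Unit v).submatrix e id) := by
    ext ⟨i, k⟩ ⟨j, l⟩
    simp only [minorSumMatrix, v, e, Matrix.neg_apply, Matrix.submatrix_apply, Matrix.add_apply,
      Matrix.mul_apply, Matrix.one_apply, Finset.univ_unique, Finset.sum_singleton,
      replicateCol_apply, replicateRow_apply, Equiv.prodComm_apply, Prod.swap_prod_mk, id,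
      Prod.mk.injEq, Pi.neg_apply]
    fin_cases i <;> fin_cases j <;> fin_cases k <;> fin_cases l <;> simp
  have hsign : Equiv.Perm.sign e = -1 := by decide
  have hdot : v ⬝ᵥ (-v) = -3 := by
    simp [v, dotProduct, Fintype.sum_prod_type]
  rw [hfac, det_neg, det_permute, det_one_add_replicateCol_mul_replicateRow, hsign, hdot]
  simp
  norm_num

set_option maxHeartbeats 1000000 in
open Matrix Kronecker in
theorem extFlattening_kronecker_congr {R : Type*} [CommRing R] (t : Fin 3 → Fin 3 → Fin 3 → R)
    (hdiag : ∀ m k, t m k k = 0) (hskew : ∀ m k l, t m k l = -t m l k) :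
    ((1 : Matrix (Fin 3) (Fin 3) R) ⊗ₖ axialMatrix t) * extFlattening t *
      ((1 : Matrix (Fin 3) (Fin 3) R) ⊗ₖ (axialMatrix t)ᵀ) =
      (axialMatrix t).det • minorSumMatrix R := by
  have h10 m := hskew m 1 0
  have h21 m := hskew m 2 1
  have h02 m := hskew m 0 2
  ext ⟨i, k⟩ ⟨j, l⟩
  simp only [Matrix.mul_apply, Fintype.sum_prod_type, kroneckerMap_apply, Matrix.one_apply,
    Matrix.smul_apply, smul_eq_mul, det_fin_three, minorSumMatrix, Matrix.transpose_apply]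
  fin_cases i <;> fin_cases j <;>
    simp [extFlattening, Fin.sum_univ_three, hdiag, h10, h21] <;>
    fin_cases k <;> fin_cases l <;> simp [axialMatrix, h02] <;> ring

open Matrix Kronecker in
theorem det_extFlattening_three {R : Type*} [CommRing R] [IsDomain R]
    (t : Fin 3 → Fin 3 → Fin 3 → R)
    (hdiag : ∀ m k, t m k k = 0) (hskew : ∀ m k l, t m k l = -t m l k)
    (hdet : (axialMatrix t).det ≠ 0) :
    (extFlattening t).det = -2 * (axialMatrix t).det ^ 3 := by
  have h := congrArg det (extFlattening_kronecker_congr t hdiag hskew)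
  simp only [det_mul, det_kronecker, det_smul, det_minorSumMatrix, det_transpose, det_one,
    Fintype.card_prod, Fintype.card_fin, one_pow, one_mul] at h
  apply mul_left_cancel₀ (pow_ne_zero 6 hdet)
  linear_combination h

theorem genericSkew_self (s : ℕ) (m : Fin 3) (k : Fin s) : genericSkew s m k k = 0 := by
  simp [genericSkew]

theorem genericSkew_skew (s : ℕ) (m : Fin 3) (k l : Fin s) :
    genericSkew s m k l = -genericSkew s m l k := by
  rcases lt_trichotomy k l with h | rfl | h
  · simp [genericSkew, h, h.not_gt]
  · simp [genericSkew]
  · simp [genericSkew, h, h.not_gt]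

theorem genericSkew_isHomogeneous (s : ℕ) (m : Fin 3) (k l : Fin s) :
    (genericSkew s m k l).IsHomogeneous 1 := by
  unfold genericSkew
  split_ifs
  · exact MvPolynomial.isHomogeneous_X _ _
  · exact (MvPolynomial.isHomogeneous_X _ _).neg
  · exact MvPolynomial.isHomogeneous_zero _ _ _

theorem det_axialMatrix_genericSkew_ne_zero : (axialMatrix (genericSkew 3)).det ≠ 0 := by
  intro h
  have h' := congrArg (MvPolynomial.eval fun p : Fin 3 × Fin 3 × Fin 3 =>
    if p = (2, 1, 2) ∨ p = (1, 0, 2) ∨ p = (0, 0, 1) then (1 : ℂ) else 0) h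
  simp [Matrix.det_fin_three, axialMatrix, genericSkew] at h'

theorem det_axialMatrix_genericSkew_isHomogeneous :
    (axialMatrix (genericSkew 3)).det.IsHomogeneous 3 := by
  have hentry (i j : Fin 3) : (axialMatrix (genericSkew 3) i j).IsHomogeneous 1 := by
    fin_cases i <;> fin_cases j <;>
      simpa [axialMatrix] using genericSkew_isHomogeneous 3 _ _ _
  have hmul (i j k l m n : Fin 3) := ((hentry i j).mul (hentry k l)).mul (hentry m n)
  rw [Matrix.det_fin_three]
  exact (((((hmul _ _ _ _ _ _).sub (hmul _ _ _ _ _ _)).sub (hmul _ _ _ _ _ _)).add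
    (hmul _ _ _ _ _ _)).add (hmul _ _ _ _ _ _)).sub (hmul _ _ _ _ _ _)

/-- For `s = 3`, `det M_3` is the cube of a cubic polynomial. -/
theorem detM_three_eq_cube :
    ∃ c : MvPolynomial (Fin 3 × Fin 3 × Fin 3) ℂ, c.totalDegree = 3 ∧ detM 3 = c ^ 3 := by
  obtain ⟨γ, hγ⟩ := IsAlgClosed.exists_pow_nat_eq (-2 : ℂ) (n := 3) (by norm_num)
  have hγ0 : γ ≠ 0 := by
    rintro rfl
    norm_num at hγ
  have hdet := det_axialMatrix_genericSkew_ne_zero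
  refine ⟨MvPolynomial.C γ * (axialMatrix (genericSkew 3)).det, ?_, ?_⟩
  · exact (det_axialMatrix_genericSkew_isHomogeneous.C_mul γ).totalDegree
      (mul_ne_zero (MvPolynomial.C_ne_zero.mpr hγ0) hdet)
  · rw [detM, det_extFlattening_three _ (genericSkew_self 3) (genericSkew_skew 3) hdet, mul_pow,
      ← map_pow, hγ, map_neg, map_ofNat]
end

section
/- For s = 4, the determinant det M_4 of the ⊠-product of a generic 3×3 skew-symmetric matrix with a generic 4×4 skew-symmetric matrix is the square of a sextic polynomial: there exists f in R_4 with total degree of f equal to 6 and det M_4 = f². -/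
open scoped BigOperators

open Matrix

/-- The `4 × 4` skew-symmetric matrix whose upper triangle, read row by row, is `v`. -/
def skewFour {R : Type*} [CommRing R] (v : Fin 6 → R) : Matrix (Fin 4) (Fin 4) R :=
  !![0, v 0, v 1, v 2; -v 0, 0, v 3, v 4; -v 1, -v 3, 0, v 5; -v 2, -v 4, -v 5, 0]

/-- The Pfaffian adjoint of `skewFour v`. -/
def skewFourAdj {R : Type*} [CommRing R] (v : Fin 6 → R) : Matrix (Fin 4) (Fin 4) R :=
  skewFour ![-v 5, v 4, -v 3, -v 2, v 1, -v 0]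

/-- The Pfaffian of `skewFour v`. -/
def pfFour {R : Type*} [CommRing R] (v : Fin 6 → R) : R :=
  v 0 * v 5 - v 1 * v 4 + v 2 * v 3

/-- The polarization of the Pfaffian `pfFour`. -/
def pfPolar {R : Type*} [CommRing R] (v w : Fin 6 → R) : R :=
  v 0 * w 5 + v 5 * w 0 - (v 1 * w 4 + v 4 * w 1) + (v 2 * w 3 + v 3 * w 2)

/-- Half of the determinant of the Gram matrix of `u`, `v`, `w` with respect to `pfPolar`. -/
def halfGram {R : Type*} [CommRing R] (u v w : Fin 6 → R) : R :=
  4 * (pfFour u * pfFour v * pfFour w) + pfPolar v w * pfPolar u w * pfPolar u v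
    - pfFour u * pfPolar v w ^ 2 - pfFour v * pfPolar u w ^ 2 - pfFour w * pfPolar u v ^ 2

section CommRing

variable {R : Type*} [CommRing R]

lemma skewFourAdj_mul_add (v w : Fin 6 → R) :
    skewFourAdj v * skewFour w + skewFourAdj w * skewFour v = pfPolar v w • 1 := by
  ext i j
  fin_cases i <;> fin_cases j <;>
    simp [skewFourAdj, skewFour, pfPolar] <;> ring

lemma skewFour_mul_adj_add (v w : Fin 6 → R) :
    skewFour v * skewFourAdj w + skewFour w * skewFourAdj v = pfPolar v w • 1 := by
  ext i j
  fin_cases i <;> fin_cases j <;>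
    simp [skewFourAdj, skewFour, pfPolar] <;> ring

lemma skewFourAdj_mul (v : Fin 6 → R) :
    skewFourAdj v * skewFour v = pfFour v • 1 := by
  ext i j
  fin_cases i <;> fin_cases j <;>
    simp [skewFourAdj, skewFour, pfFour, Matrix.mul_apply, Fin.sum_univ_four] <;> ring

lemma skewFour_mul_adj (v : Fin 6 → R) :
    skewFour v * skewFourAdj v = pfFour v • 1 := by
  ext i j
  fin_cases i <;> fin_cases j <;>
    simp [skewFourAdj, skewFour, pfFour, Matrix.mul_apply, Fin.sum_univ_four] <;> ring

lemma det_skewFourAdj (v : Fin 6 → R) : (skewFourAdj v).det = pfFour v ^ 2 := by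
  simp [skewFourAdj, skewFour, pfFour, det_succ_row_zero, Fin.sum_univ_succ, Fin.succAbove]
  ring

/-- The product `skewFourAdj u * skewFour v` is annihilated by a quadratic polynomial. -/
lemma skewFourAdj_mul_skewFour_sq (u v : Fin 6 → R) :
    skewFourAdj u * skewFour v * (skewFourAdj u * skewFour v) =
      pfPolar u v • (skewFourAdj u * skewFour v) - (pfFour u * pfFour v) • 1 := by
  have h := eq_sub_of_add_eq (skewFourAdj_mul_add u v)
  calc _ = skewFourAdj u * skewFour v *
        (pfPolar u v • 1 - skewFourAdj v * skewFour u) := by rw [← h]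
    _ = pfPolar u v • (skewFourAdj u * skewFour v) -
        skewFourAdj u * (skewFour v * skewFourAdj v) * skewFour u := by
      simp only [mul_sub, mul_smul_comm, mul_one, Matrix.mul_assoc]
    _ = _ := by
      simp only [skewFour_mul_adj, mul_smul_comm, smul_mul_assoc, mul_one, skewFourAdj_mul,
        smul_smul, mul_comm]

lemma skewFourAdj_mul_skewFour_anticomm (u v w : Fin 6 → R) :
    skewFourAdj u * skewFour v * (skewFourAdj u * skewFour w) +
        skewFourAdj u * skewFour w * (skewFourAdj u * skewFour v) =
      pfPolar u w • (skewFourAdj u * skewFour v) + pfPolar u v • (skewFourAdj u * skewFour w)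
        - (pfFour u * pfPolar v w) • 1 := by
  have key (x y : Fin 6 → R) : skewFourAdj u * skewFour x * (skewFourAdj u * skewFour y) =
      pfPolar u x • (skewFourAdj u * skewFour y) -
        pfFour u • (skewFourAdj x * skewFour y) := by
    have h := eq_sub_of_add_eq' (skewFour_mul_adj_add u x)
    calc _ = skewFourAdj u * (skewFour x * skewFourAdj u) * skewFour y := by
          simp only [Matrix.mul_assoc]
      _ = pfPolar u x • (skewFourAdj u * skewFour y) -
          skewFourAdj u * skewFour u * (skewFourAdj x * skewFour y) := by
        rw [h]
        simp only [mul_sub, sub_mul, mul_smul_comm, smul_mul_assoc, mul_one, Matrix.mul_assoc]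
      _ = _ := by rw [skewFourAdj_mul, smul_mul_assoc, one_mul]
  rw [key, key, mul_smul, ← skewFourAdj_mul_add v w, smul_add]
  abel

/-- The square of the commutator of two elements satisfying the relations of a
quaternion algebra is a scalar. -/
lemma commutator_sq_of_quadratic {S : Type*} [Ring S] [Algebra R S] {x y : S}
    {a b k l m : R} (hx : x * x = a • x - k • 1) (hy : y * y = b • y - l • 1)
    (hxy : x * y + y * x = b • x + a • y - m • 1) :
    (x * y - y * x) * (x * y - y * x) =
      (4 * (k * l) + a * b * m - m ^ 2 - k * b ^ 2 - l * a ^ 2) • -(1 : S) := by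
  have hyx : y * x = b • x + a • y - m • 1 - x * y := eq_sub_of_add_eq' hxy
  have hx' (z : S) : x * (x * z) = a • (x * z) - k • z := by
    rw [← mul_assoc, hx, sub_mul, smul_mul_assoc, smul_mul_assoc, one_mul]
  have hyx' (z : S) : y * (x * z) = b • (x * z) + a • (y * z) - m • z - x * (y * z) := by
    rw [← mul_assoc, hyx]
    simp only [sub_mul, add_mul, smul_mul_assoc, one_mul, mul_assoc]
  simp only [hyx, mul_sub, sub_mul, mul_add, add_mul, smul_mul_assoc, mul_smul_comm, one_mul,
    mul_one, mul_assoc, hx, hy, hx', hyx', smul_sub, smul_add, smul_smul]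
  module

lemma det_fromBlocks_smul_one_neg_smul_one (p : R) :
    (fromBlocks 0 (p • (1 : Matrix (Fin 4) (Fin 4) R)) (-(p • 1)) 0).det = p ^ 8 := by
  let e : Matrix (Fin 4) (Fin 4) R := 1
  have h : fromBlocks e e 0 e * fromBlocks 0 (p • e) (-(p • e)) 0 * fromBlocks e e 0 e =
      fromBlocks (-p • e) 0 (-p • e) (-p • e) := by
    simp [e, fromBlocks_multiply]
  have hdet := congrArg det h
  simp only [e, det_mul, det_fromBlocks_zero₂₁, det_fromBlocks_zero₁₂, det_smul, det_one,
    Fintype.card_fin] at hdet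
  linear_combination hdet

lemma det_blocks_mul (u v w : Fin 6 → R) :
    (fromBlocks (fromBlocks 0 (skewFour u) (-skewFour u) 0)
        (fromRows (-skewFour v) (skewFour w)) (fromCols (skewFour v) (-skewFour w)) 0).det *
      pfFour u ^ 8 =
    pfFour u ^ 8 *
      (skewFour v * skewFourAdj u * skewFour w - skewFour w * skewFourAdj u * skewFour v).det := by
  let U := fromBlocks (fromBlocks (skewFourAdj u) 0 0 (skewFourAdj u))
    (fromRows (skewFourAdj u * skewFour w) (skewFourAdj u * skewFour v)) 0
    (pfFour u • (1 : Matrix (Fin 4) (Fin 4) R))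
  have hU : U.det = pfFour u ^ 8 := by
    simp only [U, det_fromBlocks_zero₂₁, det_skewFourAdj, det_smul, det_one, Fintype.card_fin]
    ring
  rw [← hU, ← det_mul, hU]
  have hM : fromBlocks (fromBlocks 0 (skewFour u) (-skewFour u) 0)
        (fromRows (-skewFour v) (skewFour w)) (fromCols (skewFour v) (-skewFour w)) 0 * U =
      fromBlocks (fromBlocks 0 (pfFour u • 1) (-(pfFour u • 1)) 0) 0
        (fromCols (skewFour v * skewFourAdj u) (-(skewFour w * skewFourAdj u)))
        (skewFour v * skewFourAdj u * skewFour w - skewFour w * skewFourAdj u * skewFour v) := by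
    simp only [U, fromBlocks_multiply, fromBlocks_mul_fromRows, fromCols_mul_fromBlocks,
      fromCols_mul_fromRows]
    have h (X : Matrix (Fin 4) (Fin 4) R) :
        skewFour u * (skewFourAdj u * X) = pfFour u • X := by
      rw [← Matrix.mul_assoc, skewFour_mul_adj, smul_mul_assoc, one_mul]
    congr 1
    · simp [skewFour_mul_adj]
    · ext (i | i) j <;> simp [h]
    · simp
    · simp [Matrix.mul_assoc, sub_eq_add_neg]
  rw [hM, det_fromBlocks_zero₁₂]
  congr 1
  exact det_fromBlocks_smul_one_neg_smul_one _

end CommRing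

lemma det_extFlattening_skewFour_sq {R : Type*} [CommRing R] [IsDomain R] (t : Fin 3 → Fin 6 → R)
    (h0 : pfFour (t 0) ≠ 0) :
    (extFlattening fun m => skewFour (t m)).det ^ 2 = halfGram (t 0) (t 1) (t 2) ^ 4 := by
  let g : (Fin 4 ⊕ Fin 4) ⊕ Fin 4 → Fin 3 × Fin 4 :=
    Sum.elim (Sum.elim (fun i => (0, i)) fun i => (1, i)) fun i => (2, i)
  have hg : Function.Bijective g := by decide
  have hblocks : (extFlattening fun m => skewFour (t m)).submatrix
        (Equiv.ofBijective g hg) (Equiv.ofBijective g hg) =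
      fromBlocks (fromBlocks 0 (skewFour (t 0)) (-skewFour (t 0)) 0)
        (fromRows (-skewFour (t 1)) (skewFour (t 2)))
        (fromCols (skewFour (t 1)) (-skewFour (t 2))) 0 := by
    ext ((i | i) | i) ((j | j) | j) <;> simp [g, extFlattening]
  have hM := det_blocks_mul (t 0) (t 1) (t 2)
  rw [← hblocks, det_submatrix_equiv_self] at hM
  set N := skewFour (t 1) * skewFourAdj (t 0) * skewFour (t 2) -
    skewFour (t 2) * skewFourAdj (t 0) * skewFour (t 1) with hN
  have hZ := commutator_sq_of_quadratic (skewFourAdj_mul_skewFour_sq (t 0) (t 1))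
    (skewFourAdj_mul_skewFour_sq (t 0) (t 2)) (skewFourAdj_mul_skewFour_anticomm (t 0) (t 1) (t 2))
  have hZN : skewFourAdj (t 0) * skewFour (t 1) * (skewFourAdj (t 0) * skewFour (t 2)) -
      skewFourAdj (t 0) * skewFour (t 2) * (skewFourAdj (t 0) * skewFour (t 1)) =
        skewFourAdj (t 0) * N := by
    simp only [hN, mul_sub, Matrix.mul_assoc]
  rw [hZN] at hZ
  have hdet := congrArg det hZ
  simp only [det_mul, det_smul, det_neg, det_one, Fintype.card_fin, det_skewFourAdj] at hdet
  have hMN := mul_left_cancel₀ (pow_ne_zero 8 h0) ((mul_comm _ _).trans hM)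
  rw [hMN]
  refine mul_left_cancel₀ (pow_ne_zero 4 h0) ?_
  rw [halfGram]
  linear_combination hdet

/-- The upper triangle of the `m`-th slice of `genericSkew 4`. -/
noncomputable def genericUpper (m : Fin 3) : Fin 6 → MvPolynomial (Fin 3 × Fin 4 × Fin 4) ℂ :=
  ![.X (m, 0, 1), .X (m, 0, 2), .X (m, 0, 3), .X (m, 1, 2), .X (m, 1, 3), .X (m, 2, 3)]

lemma genericSkew_four_eq :
    genericSkew 4 = fun m => skewFour (genericUpper m) := by
  funext m k l
  fin_cases k <;> fin_cases l <;> rfl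

lemma isHomogeneous_genericUpper (m : Fin 3) (i : Fin 6) :
    (genericUpper m i).IsHomogeneous 1 := by
  fin_cases i <;> exact MvPolynomial.isHomogeneous_X _ _

lemma isHomogeneous_pfFour_genericUpper (m : Fin 3) :
    (pfFour (genericUpper m)).IsHomogeneous 2 := by
  have h (i j) := (isHomogeneous_genericUpper m i).mul (isHomogeneous_genericUpper m j)
  exact ((h _ _).sub (h _ _)).add (h _ _)

lemma isHomogeneous_pfPolar_genericUpper (m n : Fin 3) :
    (pfPolar (genericUpper m) (genericUpper n)).IsHomogeneous 2 := by
  have h (i j) := (isHomogeneous_genericUpper m i).mul (isHomogeneous_genericUpper n j)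
  exact (((h _ _).add (h _ _)).sub ((h _ _).add (h _ _))).add ((h _ _).add (h _ _))

lemma isHomogeneous_halfGram_genericUpper :
    (halfGram (genericUpper 0) (genericUpper 1) (genericUpper 2)).IsHomogeneous 6 := by
  have hp := isHomogeneous_pfFour_genericUpper
  have hq := isHomogeneous_pfPolar_genericUpper
  have h4 := MvPolynomial.isHomogeneous_C (Fin 3 × Fin 4 × Fin 4) (4 : ℂ)
  have h (l m n) := (hp l).mul ((hq m n).pow 2)
  exact (((((h4.mul (((hp 0).mul (hp 1)).mul (hp 2))).add
    (((hq 1 2).mul (hq 0 2)).mul (hq 0 1))).sub (h 0 1 2)).sub (h 1 0 2)).sub (h 2 0 1))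

/-- Coordinates of three mutually orthogonal skew-symmetric matrices of Pfaffian one. -/
def orthogonalPoint (x : Fin 3 × Fin 4 × Fin 4) : ℂ :=
  ![skewFour ![1, 0, 0, 0, 0, 1], skewFour ![0, 1, 0, 0, -1, 0], skewFour ![0, 0, 1, 1, 0, 0]]
    x.1 x.2.1 x.2.2

lemma pfFour_genericUpper_ne_zero : pfFour (genericUpper 0) ≠ 0 := fun h => by
  have := congrArg (MvPolynomial.eval orthogonalPoint) h
  simp [pfFour, genericUpper, orthogonalPoint, skewFour] at this

lemma halfGram_genericUpper_ne_zero :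
    halfGram (genericUpper 0) (genericUpper 1) (genericUpper 2) ≠ 0 := fun h => by
  have := congrArg (MvPolynomial.eval orthogonalPoint) h
  simp [halfGram, pfFour, pfPolar, genericUpper, orthogonalPoint, skewFour] at this

/-- For `s = 4`, `det M_4` is the square of a sextic polynomial. -/
theorem detM_four_eq_square :
    ∃ f : MvPolynomial (Fin 3 × Fin 4 × Fin 4) ℂ, f.totalDegree = 6 ∧ detM 4 = f ^ 2 := by
  have hsq := det_extFlattening_skewFour_sq genericUpper pfFour_genericUpper_ne_zero
  rw [← genericSkew_four_eq] at hsq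
  set g := halfGram (genericUpper 0) (genericUpper 1) (genericUpper 2)
  have hdeg (z : ℂ) (hz : z ≠ 0) : (MvPolynomial.C z * g).totalDegree = 6 :=
    (isHomogeneous_halfGram_genericUpper.C_mul z).totalDegree
      (mul_ne_zero (MvPolynomial.C_ne_zero.mpr hz) halfGram_genericUpper_ne_zero)
  have hsq' : detM 4 ^ 2 = (g ^ 2) ^ 2 := by
    rw [← pow_mul]
    exact hsq
  rcases sq_eq_sq_iff_eq_or_eq_neg.mp hsq' with h | h
  · exact ⟨_, hdeg 1 one_ne_zero, by simpa using h⟩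
  · refine ⟨_, hdeg Complex.I Complex.I_ne_zero, ?_⟩
    rw [h, mul_pow, ← map_pow, Complex.I_sq]
    simp
end

section
/- Let n ≥ 2, let v : Fin 3 → ℂ be nonzero, and let w, u : Fin n → ℂ be linearly independent. Then the exterior flattening Φ(t) of the rank-one tensor t m k l = v m · (w k · u l − w l · u k) has matrix rank exactly 4. -/
open scoped BigOperators

open scoped Kronecker

/-- The matrix `a bᵀ - b aᵀ` of the bivector `a ∧ b`. -/
def wedgeMatrix {m R : Type*} [CommRing R] (a b : m → R) : Matrix m m R :=
  Matrix.of fun i j => a i * b j - a j * b i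

/-- The standard symplectic `2 × 2` matrix. -/
def symplecticTwo (R : Type*) [CommRing R] : Matrix (Fin 2) (Fin 2) R := !![0, 1; -1, 0]

theorem wedgeMatrix_eq_mul {m R : Type*} [CommRing R] (a b : m → R) :
    wedgeMatrix a b =
      (Matrix.of ![a, b]).transpose * symplecticTwo R * Matrix.of ![a, b] := by
  ext i j
  simp [wedgeMatrix, symplecticTwo, Matrix.mul_apply, Fin.sum_univ_two]
  ring

theorem exists_of_mul_eq_one {m K : Type*} [Fintype m] [Field K] {a b : m → K}
    (h : LinearIndependent K ![a, b]) :
    ∃ B : Matrix m (Fin 2) K, Matrix.of ![a, b] * B = 1 := by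
  classical
  apply Matrix.mulVec_surjective_iff_exists_right_inverse.mp
  have hr : (Matrix.of ![a, b]).rank = 2 := by
    simpa using LinearIndependent.rank_matrix (M := Matrix.of ![a, b]) h
  rw [← Matrix.coe_mulVecLin, ← LinearMap.range_eq_top]
  apply Submodule.eq_top_of_finrank_eq
  simpa [Matrix.rank] using hr

theorem rank_wedgeMatrix_kronecker {m n K : Type*} [Fintype m] [Fintype n] [Field K]
    {a b : m → K} {w u : n → K} (hab : LinearIndependent K ![a, b])
    (hwu : LinearIndependent K ![w, u]) :
    (wedgeMatrix a b ⊗ₖ wedgeMatrix w u).rank = 4 := by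
  obtain ⟨B, hB⟩ := exists_of_mul_eq_one hab
  obtain ⟨C, hC⟩ := exists_of_mul_eq_one hwu
  set P := Matrix.of ![a, b]
  set Q := Matrix.of ![w, u]
  set J := symplecticTwo K ⊗ₖ symplecticTwo K with hJ
  have hM : wedgeMatrix a b ⊗ₖ wedgeMatrix w u =
      (P ⊗ₖ Q).transpose * J * (P ⊗ₖ Q) := by
    rw [wedgeMatrix_eq_mul, wedgeMatrix_eq_mul, Matrix.mul_kronecker_mul,
      Matrix.mul_kronecker_mul, Matrix.kroneckerMap_transpose]
  have hD : (P ⊗ₖ Q) * (B ⊗ₖ C) = 1 := by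
    rw [← Matrix.mul_kronecker_mul, hB, hC, Matrix.one_kronecker_one]
  have hD' : (B ⊗ₖ C).transpose * (P ⊗ₖ Q).transpose = 1 := by
    rw [← Matrix.transpose_mul, hD, Matrix.transpose_one]
  have hJ4 : J.rank = 4 := by
    rw [Matrix.rank_of_isUnit]
    · simp
    · rw [Matrix.isUnit_iff_isUnit_det, hJ, Matrix.det_kronecker]
      simp [symplecticTwo]
  rw [hM]
  apply le_antisymm
  · calc _ ≤ ((P ⊗ₖ Q).transpose * J).rank := Matrix.rank_mul_le_left _ _
      _ ≤ J.rank := Matrix.rank_mul_le_right _ _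
      _ = 4 := hJ4
  · calc 4 = J.rank := hJ4.symm
      _ = ((B ⊗ₖ C).transpose * ((P ⊗ₖ Q).transpose * J * (P ⊗ₖ Q)) * (B ⊗ₖ C)).rank := by
        rw [Matrix.mul_assoc, Matrix.mul_assoc, hD, Matrix.mul_one, ← Matrix.mul_assoc, hD',
          Matrix.one_mul]
      _ ≤ _ := (Matrix.rank_mul_le_left _ _).trans (Matrix.rank_mul_le_right _ _)

theorem linearIndependent_of_wedgeMatrix_ne_zero {m K : Type*} [Field K] {a b : m → K}
    (h : wedgeMatrix a b ≠ 0) : LinearIndependent K ![a, b] := by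
  rw [LinearIndependent.pair_iff]
  intro s t hst
  have hst' (i : m) : s * a i + t * b i = 0 := by simpa using congrFun hst i
  obtain ⟨i, j, hij⟩ : ∃ i j, wedgeMatrix a b i j ≠ 0 := by
    by_contra! hc
    exact h (Matrix.ext hc)
  simp only [wedgeMatrix, Matrix.of_apply] at hij
  constructor
  · refine (mul_eq_zero.mp ?_).resolve_right hij
    linear_combination b j * hst' i - b i * hst' j
  · refine (mul_eq_zero.mp ?_).resolve_right hij
    linear_combination a i * hst' j - a j * hst' i

/-- Every skew-symmetric `3 × 3` matrix over a field is decomposable. -/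
theorem exists_wedgeMatrix_eq {K : Type*} [Field K] (v : Fin 3 → K) :
    ∃ a b : Fin 3 → K,
      wedgeMatrix a b = !![0, v 0, -v 1; -v 0, 0, v 2; v 1, -v 2, 0] := by
  by_cases h0 : v 0 = 0
  · by_cases h1 : v 1 = 0
    · refine ⟨![0, 1, 0], ![0, 0, v 2], ?_⟩
      ext i j
      fin_cases i <;> fin_cases j <;> simp [wedgeMatrix, h0, h1]
    · refine ⟨![1, -v 2 / v 1, 0], ![0, 0, -v 1], ?_⟩
      ext i j
      fin_cases i <;> fin_cases j <;> simp [wedgeMatrix, h0, h1]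
  · refine ⟨![1, 0, -v 2 / v 0], ![0, v 0, -v 1], ?_⟩
    ext i j
    fin_cases i <;> fin_cases j <;> simp [wedgeMatrix, h0]

theorem extFlattening_eq_kronecker {n : ℕ} {R : Type*} [CommRing R] (v : Fin 3 → R)
    (w u : Fin n → R) :
    extFlattening (fun m k l => v m * (w k * u l - w l * u k)) =
      !![0, v 0, -v 1; -v 0, 0, v 2; v 1, -v 2, 0] ⊗ₖ wedgeMatrix w u := by
  ext ⟨i, k⟩ ⟨j, l⟩
  fin_cases i <;> fin_cases j <;> simp [extFlattening, wedgeMatrix]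

/-- The exterior flattening of a rank-one partially skew-symmetric tensor
`v ⊗ (w ∧ u)` (with `v ≠ 0` and `w, u` linearly independent) has rank exactly 4. -/
theorem rank_extFlattening_rank_one (n : ℕ) (hn : 2 ≤ n) (v : Fin 3 → ℂ) (hv : v ≠ 0)
    (w u : Fin n → ℂ) (hwu : LinearIndependent ℂ ![w, u]) :
    (extFlattening (fun m k l => v m * (w k * u l - w l * u k))).rank = 4 := by
  obtain ⟨a, b, hab⟩ := exists_wedgeMatrix_eq v
  rw [extFlattening_eq_kronecker, ← hab]
  refine rank_wedgeMatrix_kronecker (linearIndependent_of_wedgeMatrix_ne_zero ?_) hwu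
  rw [hab]
  intro h
  apply hv
  ext i
  fin_cases i
  · simpa using congrFun (congrFun h 0) 1
  · simpa using congrFun (congrFun h 2) 0
  · simpa using congrFun (congrFun h 1) 2
end

section
/- Let n ≥ 1 and r ≥ 0. For any v : Fin r → (Fin 3 → ℂ) and w, u : Fin r → (Fin n → ℂ), the exterior flattening Φ(t) of the tensor t m k l = ∑_{i : Fin r} (v i m) · ((w i k)·(u i l) − (w i l)·(u i k)) has matrix rank at most 4r. -/
open scoped BigOperators

/-- Over a field, every element of `⋀² K³` is decomposable. -/
theorem exists_wedge_eq_of_fin_three {K : Type*} [Field K] (v : Fin 3 → K) :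
    ∃ a b : Fin 3 → K, a 0 * b 1 - b 0 * a 1 = v 0 ∧ a 0 * b 2 - b 0 * a 2 = -v 1 ∧
      a 1 * b 2 - b 1 * a 2 = v 2 := by
  by_cases h : v 0 = 0
  · exact ⟨![0, 0, 1], ![v 1, -v 2, 0], by simp [h]⟩
  · refine ⟨![0, 1, -v 1 / v 0], ![-v 0, 0, v 2], ?_, ?_, ?_⟩ <;> simp
    field_simp

/-- If each `v i` is the wedge `a i ∧ b i`, the exterior flattening of
`∑ i, v i ⊗ (w i ∧ u i)` factors through a space of dimension `4 * r`. -/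
theorem extFlattening_sum_eq_mul {n r : ℕ} {R : Type*} [CommRing R]
    (v a b : Fin r → Fin 3 → R) (w u : Fin r → Fin n → R)
    (h01 : ∀ i, a i 0 * b i 1 - b i 0 * a i 1 = v i 0)
    (h02 : ∀ i, a i 0 * b i 2 - b i 0 * a i 2 = -v i 1)
    (h12 : ∀ i, a i 1 * b i 2 - b i 1 * a i 2 = v i 2) :
    extFlattening (fun m k l => ∑ i : Fin r, v i m * (w i k * u i l - w i l * u i k)) =
      (Matrix.of fun (p : Fin 3 × Fin n) (s : Fin r × Fin 2 × Fin 2) =>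
        ![a s.1 p.1, b s.1 p.1] s.2.1 * ![w s.1 p.2, u s.1 p.2] s.2.2) *
      (Matrix.of fun (s : Fin r × Fin 2 × Fin 2) (q : Fin 3 × Fin n) =>
        ![b s.1 q.1, -a s.1 q.1] s.2.1 * ![u s.1 q.2, -w s.1 q.2] s.2.2) := by
  have h1 (i) : v i 1 = b i 0 * a i 2 - a i 0 * b i 2 := by linear_combination h02 i
  ext ⟨i, k⟩ ⟨j, l⟩
  simp only [Matrix.mul_apply, Fintype.sum_prod_type, Fin.sum_univ_two, Matrix.of_apply,
    Matrix.cons_val_zero, Matrix.cons_val_one]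
  fin_cases i <;> fin_cases j <;>
    simp only [extFlattening, ← h01, ← h12, h1, ← Finset.sum_neg_distrib] <;>
    simp <;>
    first
    | (rw [← Finset.sum_neg_distrib]; exact Finset.sum_congr rfl fun _ _ => by ring)
    | exact Finset.sum_congr rfl fun _ _ => by ring
    | exact (Finset.sum_eq_zero fun _ _ => by ring).symm

/-- The exterior flattening of a sum of `r` rank-one partially skew-symmetric tensors
has rank at most `4r`. -/
theorem rank_extFlattening_le_of_rank_le (n : ℕ) (hn : 1 ≤ n) (r : ℕ)
    (v : Fin r → Fin 3 → ℂ) (w u : Fin r → Fin n → ℂ) :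
    (extFlattening (fun m k l =>
      ∑ i : Fin r, v i m * (w i k * u i l - w i l * u i k))).rank ≤ 4 * r := by
  choose a b h01 h02 h12 using fun i => exists_wedge_eq_of_fin_three (v i)
  rw [extFlattening_sum_eq_mul v a b w u h01 h02 h12]
  refine (Matrix.rank_mul_le_left _ _).trans ((Matrix.rank_le_card_width _).trans ?_)
  simp only [Fintype.card_prod, Fintype.card_fin]
  lia
end

section
/- Let ℓ ≥ 1 and set n = 4ℓ+3. For any v : Fin (3ℓ+2) → (Fin 3 → ℂ) and w, u : Fin (3ℓ+2) → (Fin n → ℂ), the determinant of the exterior flattening Φ(t) of the tensor t m k l = ∑_{i : Fin (3ℓ+2)} (v i m) · ((w i k)·(u i l) − (w i l)·(u i k)) is zero. (This says the determinant of the exterior flattening vanishes on the secant variety σ_{3ℓ+2}(Seg(ℙ² × 𝔾(1,4ℓ+2))).) -/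
open scoped BigOperators

/-- A square matrix that factors through a smaller index type has determinant zero. -/
theorem det_mul_eq_zero_of_card_lt {K ι κ : Type*} [Field K] [Fintype ι] [DecidableEq ι]
    [Fintype κ] (h : Fintype.card κ < Fintype.card ι) (B : Matrix ι κ K) (C : Matrix κ ι K) :
    (B * C).det = 0 := by
  by_contra hdet
  have hrank := Matrix.rank_of_isUnit (B * C)
    ((Matrix.isUnit_iff_isUnit_det _).2 (isUnit_iff_ne_zero.2 hdet))
  have hle := (Matrix.rank_mul_le_left B C).trans (Matrix.rank_le_card_width B)
  omega

/-- Every vector `(v 2, v 1, v 0)` is the cross product of some vectors `a` and `b`. -/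
theorem exists_cross_eq {K : Type*} [Field K] (v : Fin 3 → K) :
    ∃ a b : Fin 3 → K, v 0 = a 0 * b 1 - b 0 * a 1 ∧ -v 1 = a 0 * b 2 - b 0 * a 2 ∧
      v 2 = a 1 * b 2 - b 1 * a 2 := by
  by_cases h0 : v 0 = 0
  · exact ⟨![-v 1, v 2, 0], ![0, 0, 1], by simp [h0]⟩
  · refine ⟨![v 0, 0, -v 2], ![0, 1, -v 1 / v 0], ?_, ?_, ?_⟩ <;> simp [field]

/-- The determinant of the exterior flattening vanishes on the secant variety
`σ_{3ℓ+2}(Seg(ℙ² × 𝔾(1,4ℓ+2)))`. -/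
theorem det_extFlattening_eq_zero_on_secant (ℓ : ℕ) (hℓ : 1 ≤ ℓ)
    (v : Fin (3 * ℓ + 2) → Fin 3 → ℂ)
    (w u : Fin (3 * ℓ + 2) → Fin (4 * ℓ + 3) → ℂ) :
    (extFlattening (fun m k l =>
      ∑ i : Fin (3 * ℓ + 2), v i m * (w i k * u i l - w i l * u i k))).det = 0 := by
  choose a b h01 h02 h12 using fun i => exists_cross_eq (v i)
  let B : Matrix (Fin 3 × Fin (4 * ℓ + 3)) (Fin (3 * ℓ + 2) × Fin 2 × Fin 2) ℂ := fun p s =>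
    ![a s.1, -b s.1] s.2.1 p.1 * ![w s.1, -u s.1] s.2.2 p.2
  let C : Matrix (Fin (3 * ℓ + 2) × Fin 2 × Fin 2) (Fin 3 × Fin (4 * ℓ + 3)) ℂ := fun s q =>
    ![b s.1, a s.1] s.2.1 q.1 * ![u s.1, w s.1] s.2.2 q.2
  have hBC : extFlattening (fun m k l =>
      ∑ i : Fin (3 * ℓ + 2), v i m * (w i k * u i l - w i l * u i k)) = B * C := by
    ext ⟨i, k⟩ ⟨j, l⟩
    have hmul : (B * C) (i, k) (j, l) = ∑ s : Fin (3 * ℓ + 2), (a s i * b s j - b s i * a s j) *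
        (w s k * u s l - w s l * u s k) := by
      rw [Matrix.mul_apply, Fintype.sum_prod_type]
      refine Finset.sum_congr rfl fun s _ => ?_
      simp [Fintype.sum_prod_type, B, C]
      ring
    rw [hmul]
    fin_cases i <;> fin_cases j <;>
      simp only [extFlattening, Fin.zero_eta, Fin.mk_one, Fin.reduceFinMk, Fin.reduceEq,
        Fin.isValue, and_true, and_false, and_self, if_true, if_false, zero_ne_one, one_ne_zero,
        ← Finset.sum_neg_distrib]
    all_goals
      first
      | refine Finset.sum_congr rfl fun s _ => ?_
      | refine (Finset.sum_eq_zero fun s _ => ?_).symm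
      first
      | ring1
      | linear_combination (w s k * u s l - w s l * u s k) * h01 s
      | linear_combination -(w s k * u s l - w s l * u s k) * h01 s
      | linear_combination (w s k * u s l - w s l * u s k) * h02 s
      | linear_combination -(w s k * u s l - w s l * u s k) * h02 s
      | linear_combination (w s k * u s l - w s l * u s k) * h12 s
      | linear_combination -(w s k * u s l - w s l * u s k) * h12 s
  rw [hBC]
  refine det_mul_eq_zero_of_card_lt ?_ B C
  simp only [Fintype.card_prod, Fintype.card_fin]
  omega
end
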